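/- arXiv:2411.11136 — 7 statements merged into one kernel-verified Lean document; each statement's English description precedes it below -/
import Mathlib

section
/- Let k ≥ 2 be an integer, let G be a finite simple graph, and let P be a k^+-star packing of G satisfying conditions (C1), (C2), (C3), (C4) and (C5). Then for every k^+-star packing Q of G, the number of vertices covered by Q is at most (1 + k^2/(2k+1)) times the number of vertices covered by P, i.e., |V(Q)| ≤ (1 + k^2/(2k+1))·|V(P)|. (This is the combinatorial content of the (1 + k^2/(2k+1))-approximation guarantee of the local search algorithm LocalSearch-k^+.) -/
open SimpleGraph

variable {V : Type*}

/-- A star in a graph `G`: a center together with a finite set of satellites, each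
adjacent to the center.  An `ℓ`-star is such a star with `sats.card = ℓ`. -/
structure GStar (G : SimpleGraph V) where
  center : V
  sats : Finset V
  center_not_mem : center ∉ sats
  adj : ∀ v ∈ sats, G.Adj center v

/-- The vertex set of a star. -/
def GStar.verts {G : SimpleGraph V} (S : GStar G) : Set V :=
  insert S.center ↑S.sats

/-- The set of vertices covered by a collection of stars. -/
def coverSet {G : SimpleGraph V} (P : Set (GStar G)) : Set V :=
  ⋃ S ∈ P, S.verts

/-- A `k⁺`-star packing: pairwise vertex-disjoint stars, each with at least `k` satellites. -/
def IsKPlusPacking {G : SimpleGraph V} (k : ℕ) (P : Set (GStar G)) : Prop :=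
  (∀ S ∈ P, k ≤ S.sats.card) ∧
  P.Pairwise fun S T => Disjoint S.verts T.verts

/-- (C1) no vertex uncovered by `P` has `k` or more uncovered neighbors, and no uncovered
vertex is adjacent to the center of a star of `P`. -/
def CondC1 {G : SimpleGraph V} (k : ℕ) (P : Set (GStar G)) : Prop :=
  ∀ v ∈ (coverSet P)ᶜ,
    (G.neighborSet v ∩ (coverSet P)ᶜ).ncard < k ∧
    ∀ S ∈ P, ¬ G.Adj v S.center

/-- (C2) for every star `S` of `P` with at least `k+1` satellites and every satellite `v`
of `S`, there is no `k⁺`-star of `G` whose vertex set lies in `{v} ∪ (V ∖ V(P))`. -/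
def CondC2 {G : SimpleGraph V} (k : ℕ) (P : Set (GStar G)) : Prop :=
  ∀ S ∈ P, k + 1 ≤ S.sats.card → ∀ v ∈ S.sats,
    ¬ ∃ T : GStar G, k ≤ T.sats.card ∧ T.verts ⊆ insert v (coverSet P)ᶜ

/-- (C3) for every star `S` of `P` with exactly `k` satellites, no `(k+1)⁺`-star and no
pair of vertex-disjoint `k`-stars fit inside `V(S) ∪ (V ∖ V(P))`. -/
def CondC3 {G : SimpleGraph V} (k : ℕ) (P : Set (GStar G)) : Prop :=
  ∀ S ∈ P, S.sats.card = k →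
    (¬ ∃ T : GStar G, k + 1 ≤ T.sats.card ∧ T.verts ⊆ S.verts ∪ (coverSet P)ᶜ) ∧
    (¬ ∃ T₁ T₂ : GStar G, T₁.sats.card = k ∧ T₂.sats.card = k ∧
        Disjoint T₁.verts T₂.verts ∧
        T₁.verts ⊆ S.verts ∪ (coverSet P)ᶜ ∧ T₂.verts ⊆ S.verts ∪ (coverSet P)ᶜ)

/-- (C4) for every `k`-star `S` of `P`, every `(k+1)⁺`-star `T` of `P` and every satellite
`x` of `T`, no pair of vertex-disjoint `k⁺`-stars fits inside `V(S) ∪ {x} ∪ (V ∖ V(P))`. -/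
def CondC4 {G : SimpleGraph V} (k : ℕ) (P : Set (GStar G)) : Prop :=
  ∀ S ∈ P, S.sats.card = k → ∀ T ∈ P, k + 1 ≤ T.sats.card → ∀ x ∈ T.sats,
    ¬ ∃ A B : GStar G, k ≤ A.sats.card ∧ k ≤ B.sats.card ∧
        Disjoint A.verts B.verts ∧
        A.verts ⊆ S.verts ∪ {x} ∪ (coverSet P)ᶜ ∧
        B.verts ⊆ S.verts ∪ {x} ∪ (coverSet P)ᶜ

/-- (C5) for every two distinct `k`-stars `S, T` of `P`, neither a vertex-disjoint pair
consisting of a `k⁺`-star and a `(k+1)⁺`-star, nor a triple of pairwise vertex-disjoint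
`k`-stars, fits inside `V(S) ∪ V(T) ∪ (V ∖ V(P))`. -/
def CondC5 {G : SimpleGraph V} (k : ℕ) (P : Set (GStar G)) : Prop :=
  ∀ S ∈ P, ∀ T ∈ P, S ≠ T → S.sats.card = k → T.sats.card = k →
    (¬ ∃ A B : GStar G, k ≤ A.sats.card ∧ k + 1 ≤ B.sats.card ∧
        Disjoint A.verts B.verts ∧
        A.verts ⊆ S.verts ∪ T.verts ∪ (coverSet P)ᶜ ∧
        B.verts ⊆ S.verts ∪ T.verts ∪ (coverSet P)ᶜ) ∧
    (¬ ∃ A B C : GStar G, A.sats.card = k ∧ B.sats.card = k ∧ C.sats.card = k ∧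
        Disjoint A.verts B.verts ∧ Disjoint A.verts C.verts ∧ Disjoint B.verts C.verts ∧
        A.verts ⊆ S.verts ∪ T.verts ∪ (coverSet P)ᶜ ∧
        B.verts ⊆ S.verts ∪ T.verts ∪ (coverSet P)ᶜ ∧
        C.verts ⊆ S.verts ∪ T.verts ∪ (coverSet P)ᶜ)

/-- (C6, for `k = 2`) for every three distinct `2`-stars `S, T, U` of `P`, no triple of
pairwise vertex-disjoint stars consisting of two `2`-stars and a `3⁺`-star fits inside
`V(S) ∪ V(T) ∪ V(U) ∪ (V ∖ V(P))`. -/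
def CondC6 {G : SimpleGraph V} (P : Set (GStar G)) : Prop :=
  ∀ S ∈ P, ∀ T ∈ P, ∀ U ∈ P, S ≠ T → S ≠ U → T ≠ U →
    S.sats.card = 2 → T.sats.card = 2 → U.sats.card = 2 →
    ¬ ∃ A B C : GStar G, A.sats.card = 2 ∧ B.sats.card = 2 ∧ 3 ≤ C.sats.card ∧
        Disjoint A.verts B.verts ∧ Disjoint A.verts C.verts ∧ Disjoint B.verts C.verts ∧
        A.verts ⊆ S.verts ∪ T.verts ∪ U.verts ∪ (coverSet P)ᶜ ∧
        B.verts ⊆ S.verts ∪ T.verts ∪ U.verts ∪ (coverSet P)ᶜ ∧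
        C.verts ⊆ S.verts ∪ T.verts ∪ U.verts ∪ (coverSet P)ᶜ

section LocalSearchRatio

open Finset

open scoped Classical

variable {G : SimpleGraph V} {k : ℕ} {P Q : Set (GStar G)}

/-- The vertices of a star, as a finset. -/
def GStar.vertFinset (S : GStar G) : Finset V :=
  S.sats.cons S.center S.center_not_mem

lemma GStar.mem_vertFinset {S : GStar G} {v : V} : v ∈ S.vertFinset ↔ v ∈ S.verts := by
  simp [GStar.vertFinset, GStar.verts]

lemma GStar.card_vertFinset (S : GStar G) : S.vertFinset.card = S.sats.card + 1 :=
  card_cons _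

lemma GStar.center_mem_verts (S : GStar G) : S.center ∈ S.verts := by
  simp [GStar.verts]

lemma GStar.mem_verts_iff {S : GStar G} {v : V} : v ∈ S.verts ↔ v = S.center ∨ v ∈ S.sats := by
  simp [GStar.verts]

/-- A set of vertices of a star that contains the center spans a star. -/
lemma GStar.exists_verts_eq (T : GStar G) (X : Finset V) (hX : ∀ x ∈ X, x ∈ T.verts)
    (hc : T.center ∈ X) : ∃ A : GStar G, A.verts = ↑X ∧ A.sats.card + 1 = X.card := by
  refine ⟨⟨T.center, X.erase T.center, by simp, ?_⟩, ?_, ?_⟩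
  · intro v hv
    rw [mem_erase] at hv
    exact T.adj v ((GStar.mem_verts_iff.1 (hX v hv.2)).resolve_left hv.1)
  · ext v
    by_cases hv : v = T.center <;> simp [GStar.verts, hv, hc]
  · exact card_erase_add_one hc

instance [Finite V] : Finite (GStar G) := by
  refine Finite.of_injective (fun S : GStar G => (S.center, S.sats)) ?_
  rintro ⟨c, s, _, _⟩ ⟨c', s', _, _⟩ h
  simp only [Prod.mk.injEq] at h
  obtain ⟨rfl, rfl⟩ := h
  rfl

lemma mem_coverSet {v : V} : v ∈ coverSet P ↔ ∃ S ∈ P, v ∈ S.verts := by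
  simp [coverSet]

lemma IsKPlusPacking.eq_of_mem (hP : IsKPlusPacking k P) {S T : GStar G} (hS : S ∈ P) (hT : T ∈ P)
    {v : V} (hvS : v ∈ S.verts) (hvT : v ∈ T.verts) : S = T := by
  by_contra h
  exact Set.disjoint_left.1 (hP.2 hS hT h) hvS hvT

lemma IsKPlusPacking.disjoint_of_subset (hP : IsKPlusPacking k P) {S T : GStar G} (hS : S ∈ P)
    (hT : T ∈ P) (hST : S ≠ T) {A B : Set V} (hA : A ⊆ S.verts) (hB : B ⊆ T.verts) :
    Disjoint A B :=
  (hP.2 hS hT hST).mono hA hB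

/-- The vertices of a star that are left uncovered by `P`. -/
noncomputable def freePart (P : Set (GStar G)) (T : GStar G) : Finset V :=
  T.vertFinset.filter (· ∉ coverSet P)

/-- The vertices of a star that are covered by `P`. -/
noncomputable def hitPart (P : Set (GStar G)) (T : GStar G) : Finset V :=
  T.vertFinset.filter (· ∈ coverSet P)

lemma mem_freePart {T : GStar G} {v : V} : v ∈ freePart P T ↔ v ∈ T.verts ∧ v ∉ coverSet P := by
  simp [freePart, GStar.mem_vertFinset]

lemma mem_hitPart {T : GStar G} {v : V} : v ∈ hitPart P T ↔ v ∈ T.verts ∧ v ∈ coverSet P := by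
  simp [hitPart, GStar.mem_vertFinset]

lemma card_hitPart_add_card_freePart (P : Set (GStar G)) (T : GStar G) :
    (hitPart P T).card + (freePart P T).card = T.sats.card + 1 := by
  rw [← T.card_vertFinset]
  exact card_filter_add_card_filter_not _

/-- A star that meets `V(P)` only in `v` has `v` as a satellite of a star of `P` with exactly
`k` satellites. -/
lemma card_sats_eq_of_verts_subset (hk : 2 ≤ k) (hP : IsKPlusPacking k P) (h1 : CondC1 k P)
    (h2 : CondC2 k P) {S : GStar G} (hS : S ∈ P) {v : V} (hv : v ∈ S.verts) {A : GStar G}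
    (hA : k ≤ A.sats.card) (hAv : A.verts ⊆ insert v (coverSet P)ᶜ) (hvA : v ∈ A.verts) :
    S.sats.card = k := by
  have hne : v ≠ S.center := by
    rintro rfl
    rcases GStar.mem_verts_iff.1 hvA with h | h
    · obtain ⟨w, hw⟩ := Finset.card_pos.1 (by omega : 0 < A.sats.card)
      have hadj := A.adj w hw
      rcases hAv (GStar.mem_verts_iff.2 (Or.inr hw)) with h' | h'
      · exact A.center_not_mem (by rw [← h, ← h']; exact hw)
      · exact (h1 w h').2 S hS (by rw [h]; exact hadj.symm)
    · rcases hAv A.center_mem_verts with h' | h'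
      · exact A.center_not_mem (by rw [h']; exact h)
      · exact (h1 _ h').2 S hS (A.adj _ h)
  have hvs := (GStar.mem_verts_iff.1 hv).resolve_left hne
  by_contra hcard
  have := hP.1 S hS
  exact h2 S hS (by omega) v hvs ⟨A, hA, hAv⟩

lemma insert_subset_verts_union {S : GStar G} {v : V} (hv : v ∈ S.verts) :
    insert v (coverSet P)ᶜ ⊆ S.verts ∪ (coverSet P)ᶜ :=
  Set.insert_subset (Or.inl hv) Set.subset_union_right

/-- Every star has at most `k` vertices uncovered by `P`. -/
lemma card_freePart_le [Fintype V] (hk : 2 ≤ k) (hP : IsKPlusPacking k P) (h1 : CondC1 k P)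
    (h2 : CondC2 k P) (h3 : CondC3 k P) (T : GStar G) : (freePart P T).card ≤ k := by
  by_contra! hlt
  by_cases hc : T.center ∈ coverSet P
  · obtain ⟨S, hS, hcS⟩ := mem_coverSet.1 hc
    obtain ⟨A, hAv, hAc⟩ := T.exists_verts_eq (insert T.center (freePart P T))
      (by
        intro x hx
        rcases mem_insert.1 hx with rfl | hx
        · exact T.center_mem_verts
        · exact (mem_freePart.1 hx).1) (mem_insert_self _ _)
    rw [card_insert_of_notMem (by simp [mem_freePart, hc])] at hAc
    have hsub : A.verts ⊆ insert T.center (coverSet P)ᶜ := by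
      intro x hx
      rw [hAv, mem_coe, mem_insert] at hx
      exact hx.imp id fun h => (mem_freePart.1 h).2
    have hS' := card_sats_eq_of_verts_subset hk hP h1 h2 hS hcS (by omega) hsub (by simp [hAv])
    exact (h3 S hS hS').1 ⟨A, by omega, hsub.trans (insert_subset_verts_union hcS)⟩
  · have h := (h1 _ hc).1
    have hcm : T.center ∈ freePart P T := mem_freePart.2 ⟨T.center_mem_verts, hc⟩
    have hsub : (↑((freePart P T).erase T.center) : Set V) ⊆
        G.neighborSet T.center ∩ (coverSet P)ᶜ := by
      intro x hx
      rw [mem_coe, mem_erase, mem_freePart] at hx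
      exact ⟨T.adj x ((GStar.mem_verts_iff.1 hx.2.1).resolve_left hx.1), hx.2.2⟩
    have := Set.ncard_le_ncard hsub (Set.toFinite _)
    rw [Set.ncard_coe_finset] at this
    have := card_erase_add_one hcm
    omega

/-- `T` is a star of `Q` with `k` vertices uncovered by `P` that, together with the covered
vertex `v`, contain a `k`-star. -/
def IsCritStar (k : ℕ) (P Q : Set (GStar G)) (T : GStar G) (v : V) : Prop :=
  T ∈ Q ∧ (freePart P T).card = k ∧ v ∈ hitPart P T ∧ (T.center = v ∨ T.center ∉ coverSet P)

/-- A covered vertex that completes the uncovered vertices of a star of `Q` to a `k`-star. -/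
def IsCrit (k : ℕ) (P Q : Set (GStar G)) (v : V) : Prop :=
  ∃ T, IsCritStar k P Q T v

/-- A critical vertex that has to pay for all uncovered vertices of its star of `Q`. -/
def IsFull (k : ℕ) (P Q : Set (GStar G)) (v : V) : Prop :=
  ∃ T, IsCritStar k P Q T v ∧ (T.center = v ∨ hitPart P T = {v})

lemma IsFull.isCrit {v : V} (h : IsFull k P Q v) : IsCrit k P Q v :=
  h.imp fun _ h => h.1

lemma IsCritStar.exists_star {T : GStar G} {v : V} (h : IsCritStar k P Q T v) :
    ∃ A : GStar G, A.sats.card = k ∧ A.verts ⊆ insert v (coverSet P)ᶜ ∧ v ∈ A.verts ∧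
      A.verts ⊆ T.verts := by
  obtain ⟨-, hcard, hv, hc⟩ := h
  rw [mem_hitPart] at hv
  obtain ⟨A, hAv, hAc⟩ := T.exists_verts_eq (insert v (freePart P T))
    (by
      intro x hx
      rcases mem_insert.1 hx with rfl | hx
      · exact hv.1
      · exact (mem_freePart.1 hx).1)
    (by
      rcases hc with rfl | hc
      · exact mem_insert_self _ _
      · exact mem_insert_of_mem (mem_freePart.2 ⟨T.center_mem_verts, hc⟩))
  rw [card_insert_of_notMem (by simp [mem_freePart, hv.2])] at hAc
  refine ⟨A, by omega, ?_, by simp [hAv], ?_⟩ <;> intro x hx <;>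
    rw [hAv, mem_coe, mem_insert, mem_freePart] at hx
  · exact hx.imp id And.right
  · rcases hx with rfl | hx
    exacts [hv.1, hx.1]

lemma IsCrit.card_sats_eq (hk : 2 ≤ k) (hP : IsKPlusPacking k P) (h1 : CondC1 k P)
    (h2 : CondC2 k P) {S : GStar G} (hS : S ∈ P) {v : V} (hv : v ∈ S.verts)
    (h : IsCrit k P Q v) : S.sats.card = k := by
  obtain ⟨T, hT⟩ := h
  obtain ⟨A, hA, hAv, hvA, -⟩ := hT.exists_star
  exact card_sats_eq_of_verts_subset hk hP h1 h2 hS hv hA.ge hAv hvA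

/-- Each star of `P` has at most one critical vertex. -/
lemma IsCrit.unique (hk : 2 ≤ k) (hP : IsKPlusPacking k P) (hQ : IsKPlusPacking k Q)
    (h1 : CondC1 k P) (h2 : CondC2 k P) (h3 : CondC3 k P) {S : GStar G} (hS : S ∈ P) {v w : V}
    (hv : v ∈ S.verts) (hw : w ∈ S.verts) (hcv : IsCrit k P Q v) (hcw : IsCrit k P Q w) :
    v = w := by
  have hSk := hcv.card_sats_eq hk hP h1 h2 hS hv
  obtain ⟨T, hT⟩ := hcv
  obtain ⟨T', hT'⟩ := hcw
  by_contra hne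
  by_cases hTT : T = T'
  · subst hTT
    obtain ⟨-, hcard, hvT, hc⟩ := hT
    obtain ⟨-, -, hwT, hc'⟩ := hT'
    rw [mem_hitPart] at hvT hwT
    have hcc : T.center ∉ coverSet P := by
      rcases hc with rfl | hc
      · exact hc'.resolve_left hne
      · exact hc
    obtain ⟨A, hAv, hAc⟩ := T.exists_verts_eq (insert v (insert w (freePart P T)))
      (by
        intro x hx
        rw [mem_insert, mem_insert, mem_freePart] at hx
        rcases hx with rfl | rfl | hx
        exacts [hvT.1, hwT.1, hx.1])
      (by simp [mem_freePart, T.center_mem_verts, hcc])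
    rw [card_insert_of_notMem (by simp [mem_freePart, hvT.2, hne]),
      card_insert_of_notMem (by simp [mem_freePart, hwT.2])] at hAc
    refine (h3 S hS hSk).1 ⟨A, by omega, ?_⟩
    intro x hx
    rw [hAv, mem_coe, mem_insert, mem_insert, mem_freePart] at hx
    rcases hx with rfl | rfl | hx
    exacts [Or.inl hv, Or.inl hw, Or.inr hx.2]
  · obtain ⟨A, hA, hAv, -, hAT⟩ := hT.exists_star
    obtain ⟨B, hB, hBv, -, hBT⟩ := hT'.exists_star
    exact (h3 S hS hSk).2 ⟨A, B, hA, hB, hQ.disjoint_of_subset hT.1 hT'.1 hTT hAT hBT,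
      hAv.trans (insert_subset_verts_union hv), hBv.trans (insert_subset_verts_union hw)⟩

/-- The star of `P` through `v` contains a full vertex. -/
def NearFull (k : ℕ) (P Q : Set (GStar G)) (v : V) : Prop :=
  ∃ S ∈ P, v ∈ S.verts ∧ ∃ w ∈ S.verts, IsFull k P Q w

/-- The star of `P` through `v` contains a critical vertex. -/
def NearCrit (k : ℕ) (P Q : Set (GStar G)) (v : V) : Prop :=
  ∃ S ∈ P, v ∈ S.verts ∧ ∃ w ∈ S.verts, IsCrit k P Q w

/-- A `k`-star inside a non-saturated star of `Q` cannot meet `V(P)` only in a vertex near a full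
vertex and a vertex near a critical vertex. -/
lemma not_nearFull_and_nearCrit (hk : 2 ≤ k) (hP : IsKPlusPacking k P) (hQ : IsKPlusPacking k Q)
    (h1 : CondC1 k P) (h2 : CondC2 k P) (h3 : CondC3 k P) (h5 : CondC5 k P) {T B : GStar G}
    (hT : T ∈ Q) (hTk : (freePart P T).card ≠ k) {x y : V} (hB : B.sats.card = k)
    (hBv : B.verts ⊆ insert x (insert y (coverSet P)ᶜ)) (hBT : B.verts ⊆ T.verts)
    (hx : NearFull k P Q x) (hy : NearCrit k P Q y) : False := by
  obtain ⟨S, hS, hxS, v, hvS, T₁, hT₁, hfull⟩ := hx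
  obtain ⟨S', hS', hyS, w, hwS, T₂, hT₂⟩ := hy
  have hSk := IsCrit.card_sats_eq hk hP h1 h2 hS hvS ⟨T₁, hT₁⟩
  have hSk' := IsCrit.card_sats_eq hk hP h1 h2 hS' hwS ⟨T₂, hT₂⟩
  have hne₁ : T ≠ T₁ := fun h => hTk (h ▸ hT₁.2.1)
  have hne₂ : T ≠ T₂ := fun h => hTk (h ▸ hT₂.2.1)
  obtain ⟨A₁, hA₁, hA₁v, -, hA₁T⟩ := hT₁.exists_star
  obtain ⟨A₂, hA₂, hA₂v, -, hA₂T⟩ := hT₂.exists_star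
  by_cases hSS : S = S'
  · subst hSS
    refine (h3 S hS hSk).2 ⟨B, A₁, hB, hA₁, hQ.disjoint_of_subset hT hT₁.1 hne₁ hBT hA₁T, ?_,
      hA₁v.trans (insert_subset_verts_union hvS)⟩
    exact hBv.trans (Set.insert_subset (Or.inl hxS) (insert_subset_verts_union hyS))
  · have hvw : v ≠ w := by
      rintro rfl
      exact hSS (hP.eq_of_mem hS hS' hvS hwS)
    have hne₁₂ : T₁ ≠ T₂ := by
      rintro rfl
      rcases hfull with rfl | h
      · rcases hT₂.2.2.2 with h | h
        · exact hvw h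
        · exact h (mem_coverSet.2 ⟨S, hS, hvS⟩)
      · have := hT₂.2.2.1
        rw [h, mem_singleton] at this
        exact hvw this.symm
    have hU : (coverSet P)ᶜ ⊆ S.verts ∪ S'.verts ∪ (coverSet P)ᶜ := Set.subset_union_right
    refine (h5 S hS S' hS' hSS hSk hSk').2 ⟨B, A₁, A₂, hB, hA₁, hA₂,
      hQ.disjoint_of_subset hT hT₁.1 hne₁ hBT hA₁T, hQ.disjoint_of_subset hT hT₂.1 hne₂ hBT hA₂T,
      hQ.disjoint_of_subset hT₁.1 hT₂.1 hne₁₂ hA₁T hA₂T,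
      hBv.trans (Set.insert_subset (Or.inl (Or.inl hxS)) (Set.insert_subset
        (Or.inl (Or.inr hyS)) hU)),
      hA₁v.trans (Set.insert_subset (Or.inl (Or.inl hvS)) hU),
      hA₂v.trans (Set.insert_subset (Or.inl (Or.inr hwS)) hU)⟩

/-- The charge of a covered vertex. -/
noncomputable def charge (k : ℕ) (P Q : Set (GStar G)) (v : V) : ℝ :=
  if IsFull k P Q v then k
  else if IsCrit k P Q v then k / 2
  else if NearFull k P Q v then ((k : ℝ) ^ 2 - k - 1) / (2 * k + 1)
  else if NearCrit k P Q v then (2 * (k : ℝ) ^ 2 - 1) / (2 * (2 * k + 1))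
  else (k : ℝ) ^ 2 / (2 * k + 1)

lemma le_charge (hk : 2 ≤ k) (v : V) :
    ((k : ℝ) ^ 2 - k - 1) / (2 * k + 1) ≤ charge k P Q v := by
  have hk' : (2 : ℝ) ≤ k := by exact_mod_cast hk
  unfold charge
  split_ifs
  · rw [div_le_iff₀ (by positivity)]; nlinarith
  · rw [div_le_iff₀ (by positivity)]; nlinarith
  · exact le_rfl
  · rw [div_le_div_iff₀ (by positivity) (by positivity)]; nlinarith
  · rw [div_le_div_iff_of_pos_right (by positivity)]; nlinarith

lemma charge_nonneg (hk : 2 ≤ k) (v : V) : 0 ≤ charge k P Q v := by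
  refine le_trans ?_ (le_charge hk v)
  have hk' : (2 : ℝ) ≤ k := by exact_mod_cast hk
  exact div_nonneg (by nlinarith) (by positivity)

/-- The total charge of a star of `P`. -/
lemma sum_charge_vertFinset_le (hk : 2 ≤ k) (hP : IsKPlusPacking k P) (hQ : IsKPlusPacking k Q)
    (h1 : CondC1 k P) (h2 : CondC2 k P) (h3 : CondC3 k P) {S : GStar G} (hS : S ∈ P) :
    ∑ v ∈ S.vertFinset, charge k P Q v ≤ (k : ℝ) ^ 2 / (2 * k + 1) * S.vertFinset.card := by
  have hk' : (2 : ℝ) ≤ k := by exact_mod_cast hk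
  by_cases hcrit : ∃ v ∈ S.verts, IsCrit k P Q v
  · obtain ⟨v, hv, hvc⟩ := hcrit
    have hcard : S.vertFinset.card = k + 1 := by
      rw [S.card_vertFinset, hvc.card_sats_eq hk hP h1 h2 hS hv]
    have hvm : v ∈ S.vertFinset := GStar.mem_vertFinset.2 hv
    have hnot : ∀ w ∈ S.vertFinset.erase v, ¬ IsCrit k P Q w := fun w hw hwc =>
      (mem_erase.1 hw).1 (hwc.unique hk hP hQ h1 h2 h3 hS
        (GStar.mem_vertFinset.1 (mem_erase.1 hw).2) hv hvc)
    have hcard' : (S.vertFinset.erase v).card = k := by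
      rw [card_erase_of_mem hvm, hcard]; rfl
    rw [← add_sum_erase _ _ hvm]
    by_cases hvf : IsFull k P Q v
    · have : ∀ w ∈ S.vertFinset.erase v,
          charge k P Q w = ((k : ℝ) ^ 2 - k - 1) / (2 * k + 1) := by
        intro w hw
        have hwf : ¬ IsFull k P Q w := fun h => hnot w hw h.isCrit
        have hwn : NearFull k P Q w :=
          ⟨S, hS, GStar.mem_vertFinset.1 (mem_erase.1 hw).2, v, hv, hvf⟩
        simp [charge, hwf, hnot w hw, hwn]
      rw [sum_congr rfl this, sum_const, hcard', hcard, charge, if_pos hvf, nsmul_eq_mul]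
      apply le_of_eq
      push_cast
      field_simp
      ring
    · have : ∀ w ∈ S.vertFinset.erase v,
          charge k P Q w = (2 * (k : ℝ) ^ 2 - 1) / (2 * (2 * k + 1)) := by
        intro w hw
        have hwS := GStar.mem_vertFinset.1 (mem_erase.1 hw).2
        have hwf : ¬ IsFull k P Q w := fun h => hnot w hw h.isCrit
        have hwn : NearCrit k P Q w := ⟨S, hS, hwS, v, hv, hvc⟩
        have hwn' : ¬ NearFull k P Q w := by
          rintro ⟨S', hS', hwS', x, hx, hxf⟩
          obtain rfl := hP.eq_of_mem hS hS' hwS hwS'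
          obtain rfl := hvc.unique hk hP hQ h1 h2 h3 hS hv hx hxf.isCrit
          exact hvf hxf
        simp [charge, hwf, hnot w hw, hwn, hwn']
      rw [sum_congr rfl this, sum_const, hcard', hcard, charge, if_neg hvf, if_pos hvc,
        nsmul_eq_mul]
      apply le_of_eq
      push_cast
      field_simp
      ring
  · have : ∀ w ∈ S.vertFinset, charge k P Q w = (k : ℝ) ^ 2 / (2 * k + 1) := by
      intro w hw
      have hwS := GStar.mem_vertFinset.1 hw
      have hwc : ¬ IsCrit k P Q w := fun h => hcrit ⟨w, hwS, h⟩
      have hwf : ¬ IsFull k P Q w := fun h => hwc h.isCrit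
      have hwn : ¬ NearCrit k P Q w := by
        rintro ⟨S', hS', hwS', x, hx, hxc⟩
        obtain rfl := hP.eq_of_mem hS hS' hwS hwS'
        exact hcrit ⟨x, hx, hxc⟩
      have hwn' : ¬ NearFull k P Q w := fun ⟨S', hS', hwS', x, hx, hxf⟩ =>
        hwn ⟨S', hS', hwS', x, hx, hxf.isCrit⟩
      simp [charge, hwf, hwc, hwn, hwn']
    rw [sum_congr rfl this, sum_const, nsmul_eq_mul, mul_comm]

/-- The covered vertices of a star of `Q` pay for its uncovered vertices. -/
lemma card_freePart_le_sum_charge [Fintype V] (hk : 2 ≤ k) (hP : IsKPlusPacking k P)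
    (hQ : IsKPlusPacking k Q) (h1 : CondC1 k P) (h2 : CondC2 k P) (h3 : CondC3 k P)
    (h5 : CondC5 k P) {T : GStar G} (hT : T ∈ Q) :
    ((freePart P T).card : ℝ) ≤ ∑ v ∈ hitPart P T, charge k P Q v := by
  have hk' : (2 : ℝ) ≤ k := by exact_mod_cast hk
  have hle := card_freePart_le hk hP h1 h2 h3 T
  have hsum := card_hitPart_add_card_freePart P T
  have hTk := hQ.1 T hT
  have hnn : ∀ v ∈ hitPart P T, 0 ≤ charge k P Q v := fun v _ => charge_nonneg hk v
  by_cases hsat : (freePart P T).card = k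
  · rw [hsat]
    by_cases hc : T.center ∈ coverSet P
    · have hcm : T.center ∈ hitPart P T := mem_hitPart.2 ⟨T.center_mem_verts, hc⟩
      refine le_trans ?_ (single_le_sum hnn hcm)
      have : IsFull k P Q T.center := ⟨T, ⟨hT, hsat, hcm, Or.inl rfl⟩, Or.inl rfl⟩
      simp [charge, this]
    · have hcrit : ∀ v ∈ hitPart P T, IsCritStar k P Q T v := fun v hv =>
        ⟨hT, hsat, hv, Or.inr hc⟩
      by_cases hone : (hitPart P T).card = 1
      · obtain ⟨v, hv⟩ := card_eq_one.1 hone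
        have : IsFull k P Q v := ⟨T, hcrit v (by simp [hv]), Or.inr hv⟩
        simp [hv, charge, this]
      · have hge : ∀ v ∈ hitPart P T, (k : ℝ) / 2 ≤ charge k P Q v := by
          intro v hv
          have : IsCrit k P Q v := ⟨T, hcrit v hv⟩
          unfold charge
          split_ifs
          · linarith
          · exact le_rfl
        have h := card_nsmul_le_sum _ _ _ hge
        have h2 : (2 : ℝ) ≤ (hitPart P T).card := by
          exact_mod_cast (by omega : 2 ≤ (hitPart P T).card)
        rw [nsmul_eq_mul] at h
        nlinarith
  · have hncrit : ∀ v ∈ hitPart P T, ¬ IsCrit k P Q v := by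
      rintro v hv ⟨T', hT', hk2, hv', -⟩
      obtain rfl := hQ.eq_of_mem hT hT' (mem_hitPart.1 hv).1 (mem_hitPart.1 hv').1
      exact hsat hk2
    by_cases hk1 : (freePart P T).card + 1 = k
    · obtain ⟨x, hx, y, hy, hxy, hc⟩ : ∃ x ∈ hitPart P T, ∃ y ∈ hitPart P T, x ≠ y ∧
          (T.center = x ∨ T.center ∉ coverSet P) := by
        by_cases hc : T.center ∈ coverSet P
        · have hcm : T.center ∈ hitPart P T := mem_hitPart.2 ⟨T.center_mem_verts, hc⟩
          obtain ⟨y, hy, hne⟩ := exists_mem_ne (by omega : 1 < (hitPart P T).card) T.center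
          exact ⟨_, hcm, y, hy, hne.symm, Or.inl rfl⟩
        · obtain ⟨x, hx, y, hy, hne⟩ := one_lt_card.1 (by omega : 1 < (hitPart P T).card)
          exact ⟨x, hx, y, hy, hne, Or.inr hc⟩
      have hx' := mem_hitPart.1 hx
      have hy' := mem_hitPart.1 hy
      obtain ⟨B, hBv, hBc⟩ := T.exists_verts_eq (insert x (insert y (freePart P T)))
        (by
          intro z hz
          rw [mem_insert, mem_insert, mem_freePart] at hz
          rcases hz with rfl | rfl | hz
          exacts [hx'.1, hy'.1, hz.1])
        (by
          rcases hc with h | h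
          · simp [h]
          · simp [mem_freePart, T.center_mem_verts, h])
      rw [card_insert_of_notMem (by simp [mem_freePart, hx'.2, hxy]),
        card_insert_of_notMem (by simp [mem_freePart, hy'.2])] at hBc
      have hBU : B.verts ⊆ insert x (insert y (coverSet P)ᶜ) := by
        intro z hz
        rw [hBv, mem_coe, mem_insert, mem_insert, mem_freePart] at hz
        exact hz.imp id (Or.imp id And.right)
      have hBT : B.verts ⊆ T.verts := by
        intro z hz
        rw [hBv, mem_coe, mem_insert, mem_insert, mem_freePart] at hz
        rcases hz with rfl | rfl | hz
        exacts [hx'.1, hy'.1, hz.1]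
      have hxy1 : ¬ (NearFull k P Q x ∧ NearCrit k P Q y) := fun h =>
        not_nearFull_and_nearCrit hk hP hQ h1 h2 h3 h5 hT hsat (by omega) hBU hBT h.1 h.2
      have hyx1 : ¬ (NearFull k P Q y ∧ NearCrit k P Q x) := fun h =>
        not_nearFull_and_nearCrit hk hP hQ h1 h2 h3 h5 hT hsat (by omega)
          (by rwa [Set.insert_comm]) hBT h.1 h.2
      have hnear : ∀ v, NearFull k P Q v → NearCrit k P Q v :=
        fun v ⟨S, hS, hv, w, hw, hwf⟩ => ⟨S, hS, hv, w, hw, hwf.isCrit⟩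
      have hxf : ¬ IsFull k P Q x := fun h => hncrit x hx h.isCrit
      have hyf : ¬ IsFull k P Q y := fun h => hncrit y hy h.isCrit
      have hpair : charge k P Q x + charge k P Q y ≤ ∑ v ∈ hitPart P T, charge k P Q v := by
        rw [← sum_pair hxy]
        refine sum_le_sum_of_subset_of_nonneg ?_ fun v hv _ => hnn v hv
        intro z hz
        rw [mem_insert, mem_singleton] at hz
        rcases hz with rfl | rfl
        exacts [hx, hy]
      refine le_trans ?_ hpair
      have hkr : ((freePart P T).card : ℝ) = k - 1 := by
        rw [← hk1]; push_cast; ring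
      rw [hkr]
      have hx2 := hncrit x hx
      have hy2 := hncrit y hy
      have e1 : (k : ℝ) - 1 = ((k : ℝ) ^ 2 - k - 1) / (2 * k + 1) + (k : ℝ) ^ 2 / (2 * k + 1) := by
        field_simp
        ring
      have e2 : (2 * (k : ℝ) ^ 2 - 1) / (2 * (2 * k + 1)) ≤ (k : ℝ) ^ 2 / (2 * k + 1) := by
        rw [div_le_div_iff₀ (by positivity) (by positivity)]; nlinarith
      have e3 : (k : ℝ) - 1 ≤ 2 * ((2 * (k : ℝ) ^ 2 - 1) / (2 * (2 * k + 1))) := by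
        rw [← mul_div_assoc, mul_div_mul_left _ _ two_ne_zero, le_div_iff₀ (by positivity)]
        nlinarith
      simp only [charge, hxf, hyf, hx2, hy2, if_false]
      by_cases hxn : NearFull k P Q x
      · have hyc : ¬ NearCrit k P Q y := fun h => hxy1 ⟨hxn, h⟩
        rw [if_pos hxn, if_neg (mt (hnear y) hyc), if_neg hyc, e1]
      · by_cases hyn : NearFull k P Q y
        · have hxc : ¬ NearCrit k P Q x := fun h => hyx1 ⟨hyn, h⟩
          rw [if_neg hxn, if_neg hxc, if_pos hyn, e1, add_comm]
        · rw [if_neg hxn, if_neg hyn]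
          split_ifs <;> linarith
    · by_cases hk2 : k = 2
      · have : (freePart P T).card = 0 := by omega
        rw [this]
        simpa using sum_nonneg hnn
      · have h := card_nsmul_le_sum (hitPart P T) _ _ fun v _ => le_charge (P := P) (Q := Q) hk v
        refine le_trans ?_ h
        have hk3 : (3 : ℝ) ≤ k := by exact_mod_cast (by omega : 3 ≤ k)
        have hp3 : (3 : ℝ) ≤ (hitPart P T).card := by
          exact_mod_cast (by omega : 3 ≤ (hitPart P T).card)
        have hf : ((freePart P T).card : ℝ) ≤ k - 1 := by
          have : ((freePart P T).card : ℝ) + 1 ≤ k := by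
            exact_mod_cast (by omega : (freePart P T).card + 1 ≤ k)
          linarith
        rw [nsmul_eq_mul]
        have ha : (0 : ℝ) ≤ ((k : ℝ) ^ 2 - k - 1) / (2 * k + 1) :=
          div_nonneg (by nlinarith) (by positivity)
        have h3a : (k : ℝ) - 1 ≤ 3 * (((k : ℝ) ^ 2 - k - 1) / (2 * k + 1)) := by
          rw [← mul_div_assoc, le_div_iff₀ (by positivity)]
          nlinarith
        nlinarith

end LocalSearchRatio

/-- The local-search `k⁺`-star packing guarantee: if `P` is a `k⁺`-star packing
satisfying (C1)–(C5), then every `k⁺`-star packing `Q` covers at most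
`(1 + k²/(2k+1))` times as many vertices as `P`. -/
theorem kplus_local_search_ratio [Fintype V] (G : SimpleGraph V) (k : ℕ) (hk : 2 ≤ k)
    (P : Set (GStar G)) (hP : IsKPlusPacking k P)
    (h1 : CondC1 k P) (h2 : CondC2 k P) (h3 : CondC3 k P)
    (h4 : CondC4 k P) (h5 : CondC5 k P) :
    ∀ Q : Set (GStar G), IsKPlusPacking k Q →
      ((coverSet Q).ncard : ℝ) ≤ (1 + (k : ℝ) ^ 2 / (2 * (k : ℝ) + 1)) * (coverSet P).ncard := by
  intro Q hQ
  classical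
  set C : Finset V := Finset.univ.filter (· ∈ coverSet P) with hC
  have hCcard : (coverSet P).ncard = C.card := by
    rw [← Set.ncard_coe_finset]
    congr 1
    ext v
    simp [hC]
  have hCeq : C = P.toFinite.toFinset.biUnion GStar.vertFinset := by
    ext v
    simp [hC, mem_coverSet, GStar.mem_vertFinset]
  have hPd : (↑P.toFinite.toFinset : Set (GStar G)).PairwiseDisjoint GStar.vertFinset := by
    intro S hS T hT hST
    rw [Function.onFun, Finset.disjoint_left]
    intro v hv hv'
    exact hST (hP.eq_of_mem (by simpa using hS) (by simpa using hT)
      (GStar.mem_vertFinset.1 hv) (GStar.mem_vertFinset.1 hv'))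
  have hsumC : ∑ v ∈ C, charge k P Q v ≤ (k : ℝ) ^ 2 / (2 * k + 1) * C.card := by
    rw [hCeq, Finset.sum_biUnion hPd, Finset.card_biUnion hPd]
    push_cast
    rw [Finset.mul_sum]
    exact Finset.sum_le_sum fun S hS =>
      sum_charge_vertFinset_le hk hP hQ h1 h2 h3 (by simpa using hS)
  have hQd : (↑Q.toFinite.toFinset : Set (GStar G)).PairwiseDisjoint (hitPart P) := by
    intro S hS T hT hST
    rw [Function.onFun, Finset.disjoint_left]
    intro v hv hv'
    exact hST (hQ.eq_of_mem (by simpa using hS) (by simpa using hT)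
      (mem_hitPart.1 hv).1 (mem_hitPart.1 hv').1)
  have hfree : ((Q.toFinite.toFinset.biUnion (freePart P)).card : ℝ) ≤ ∑ v ∈ C, charge k P Q v := by
    calc ((Q.toFinite.toFinset.biUnion (freePart P)).card : ℝ)
        ≤ ∑ T ∈ Q.toFinite.toFinset, ((freePart P T).card : ℝ) := by
          exact_mod_cast Finset.card_biUnion_le
      _ ≤ ∑ T ∈ Q.toFinite.toFinset, ∑ v ∈ hitPart P T, charge k P Q v :=
          Finset.sum_le_sum fun T hT =>
            card_freePart_le_sum_charge hk hP hQ h1 h2 h3 h5 (by simpa using hT)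
      _ = ∑ v ∈ Q.toFinite.toFinset.biUnion (hitPart P), charge k P Q v :=
          (Finset.sum_biUnion hQd).symm
      _ ≤ ∑ v ∈ C, charge k P Q v := by
          refine Finset.sum_le_sum_of_subset_of_nonneg ?_ fun v _ _ => charge_nonneg hk v
          intro v hv
          simp only [Finset.mem_biUnion, mem_hitPart] at hv
          obtain ⟨T, -, -, hv⟩ := hv
          simpa [hC] using hv
  have hsub : coverSet Q ⊆ ↑(C ∪ Q.toFinite.toFinset.biUnion (freePart P)) := by
    intro v hv
    obtain ⟨T, hT, hvT⟩ := mem_coverSet.1 hv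
    by_cases hvP : v ∈ coverSet P
    · simp [hC, hvP]
    · rw [Finset.mem_coe, Finset.mem_union, Finset.mem_biUnion]
      exact Or.inr ⟨T, by simpa using hT, mem_freePart.2 ⟨hvT, hvP⟩⟩
  have hcov := (Set.ncard_le_ncard hsub (Set.toFinite _)).trans_eq (Set.ncard_coe_finset _)
  have hcov' : ((coverSet Q).ncard : ℝ) ≤
      C.card + (Q.toFinite.toFinset.biUnion (freePart P)).card := by
    exact_mod_cast hcov.trans (Finset.card_union_le _ _)
  rw [hCcard]
  linarith
end

section
/- Let k ≥ 2 be an integer, let G be a finite simple graph, and let P be a k^+-star packing of G satisfying conditions (C1), (C2) and (C3). Then: (i) every satellite of every star of P has at most k−1 neighbors uncovered by P; (ii) no satellite of a star of P with at least k+1 satellites is adjacent to an uncovered vertex that has at least k−1 neighbors uncovered by P; (iii) for every star S of P with exactly k satellites, there do not exist two distinct satellites of S both adjacent to one uncovered vertex having at least k−1 uncovered neighbors, and there do not exist two distinct satellites of S adjacent respectively to the centers of two vertex-disjoint (k−1)-stars all of whose vertices are uncovered by P; moreover, if a satellite v of S is adjacent to the center of a (k−1)-star T all of whose vertices are uncovered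 by P, then no other satellite of S has k−1 uncovered neighbors all lying outside V(T), and no two other satellites of S are both adjacent to the center of a (k−2)-star of uncovered vertices vertex-disjoint from T (for k = 2 a (k−2)-star is interpreted as a single uncovered vertex). -/
open SimpleGraph

variable {V : Type*}

namespace GStar

variable {G : SimpleGraph V}

/-- A set of at least `m` neighbors of `c` contains the satellites of an `m`-star centered
at `c`. -/
theorem exists_of_le_ncard [Finite V] {c : V} {N : Set V} {m : ℕ}
    (hN : N ⊆ G.neighborSet c) (hm : m ≤ N.ncard) :
    ∃ T : GStar G, T.center = c ∧ T.sats.card = m ∧ T.verts ⊆ insert c N := by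
  obtain ⟨s, hsN, hs⟩ := Set.exists_subset_card_eq hm
  have hfin := s.toFinite
  refine ⟨⟨c, hfin.toFinset, fun hc => ?_, fun v hv => hN (hsN (by simpa using hv))⟩, rfl, ?_, ?_⟩
  · exact G.irrefl (hN (hsN (by simpa using hc)))
  · rw [← hs, Set.ncard_eq_toFinset_card s hfin]
  · simpa [verts] using Set.insert_subset_insert hsN

/-- A star can be enlarged by a neighbor of its center lying outside the star. -/
theorem exists_insert (T : GStar G) {v : V} (hv : v ∉ T.verts) (hadj : G.Adj v T.center) :
    ∃ T' : GStar G, T'.center = T.center ∧ T'.sats.card = T.sats.card + 1 ∧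
      T'.verts = insert v T.verts := by
  classical
  have hvs : v ∉ T.sats := fun h => hv (Set.mem_insert_of_mem _ h)
  refine ⟨⟨T.center, insert v T.sats, ?_, ?_⟩, rfl, Finset.card_insert_of_notMem hvs, ?_⟩
  · simp [T.center_not_mem, hadj.ne']
  · intro x hx
    obtain rfl | hx := Finset.mem_insert.1 hx
    exacts [hadj.symm, T.adj x hx]
  · simp [verts, Set.insert_comm]

theorem center_mem_verts_s2 (S : GStar G) : S.center ∈ S.verts := Set.mem_insert _ _

theorem mem_verts_of_mem_sats {S : GStar G} {v : V} (hv : v ∈ S.sats) : v ∈ S.verts :=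
  Set.mem_insert_of_mem _ hv

theorem verts_subset_coverSet {P : Set (GStar G)} {S : GStar G} (hS : S ∈ P) :
    S.verts ⊆ coverSet P :=
  Set.subset_biUnion_of_mem (u := GStar.verts) hS

end GStar

/-- Lemma 2 of the paper: structural consequences of conditions (C1)–(C3) for a
`k⁺`-star packing `P`. -/
theorem kplus_stability_structure [Fintype V] (G : SimpleGraph V) (k : ℕ) (hk : 2 ≤ k)
    (P : Set (GStar G)) (hP : IsKPlusPacking k P)
    (h1 : CondC1 k P) (h2 : CondC2 k P) (h3 : CondC3 k P) :
    -- (i) every satellite of every star of `P` has at most `k-1` uncovered neighbors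
    (∀ S ∈ P, ∀ v ∈ S.sats,
      (G.neighborSet v ∩ (coverSet P)ᶜ).ncard ≤ k - 1) ∧
    -- (ii) no satellite of a `(k+1)⁺`-star of `P` is adjacent to an uncovered vertex
    -- having at least `k-1` uncovered neighbors
    (∀ S ∈ P, k + 1 ≤ S.sats.card → ∀ v ∈ S.sats, ∀ u ∈ (coverSet P)ᶜ,
      G.Adj v u → ¬ (k - 1 ≤ (G.neighborSet u ∩ (coverSet P)ᶜ).ncard)) ∧
    -- (iii) properties of the `k`-stars of `P`
    (∀ S ∈ P, S.sats.card = k →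
      -- no two distinct satellites of `S` are both adjacent to one uncovered vertex
      -- having at least `k-1` uncovered neighbors
      (¬ ∃ v₁ ∈ S.sats, ∃ v₂ ∈ S.sats, v₁ ≠ v₂ ∧ ∃ u ∈ (coverSet P)ᶜ,
          G.Adj v₁ u ∧ G.Adj v₂ u ∧
          k - 1 ≤ (G.neighborSet u ∩ (coverSet P)ᶜ).ncard) ∧
      -- no two distinct satellites of `S` are adjacent respectively to the centers of
      -- two vertex-disjoint uncovered `(k-1)`-stars
      (¬ ∃ v₁ ∈ S.sats, ∃ v₂ ∈ S.sats, v₁ ≠ v₂ ∧ ∃ T₁ T₂ : GStar G,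
          T₁.sats.card = k - 1 ∧ T₂.sats.card = k - 1 ∧
          Disjoint T₁.verts T₂.verts ∧
          T₁.verts ⊆ (coverSet P)ᶜ ∧ T₂.verts ⊆ (coverSet P)ᶜ ∧
          G.Adj v₁ T₁.center ∧ G.Adj v₂ T₂.center) ∧
      -- moreover, if a satellite `v` of `S` is adjacent to the center of an uncovered
      -- `(k-1)`-star `T` then:
      (∀ v ∈ S.sats, ∀ T : GStar G, T.sats.card = k - 1 → T.verts ⊆ (coverSet P)ᶜ →
        G.Adj v T.center →
        -- no other satellite of `S` has `k-1` uncovered neighbors all outside `V(T)`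
        (∀ w ∈ S.sats, w ≠ v →
          ¬ (k - 1 ≤ ((G.neighborSet w ∩ (coverSet P)ᶜ) \ T.verts).ncard)) ∧
        -- and no two other satellites of `S` are both adjacent to the center of an
        -- uncovered `(k-2)`-star vertex-disjoint from `T`
        -- (for `k = 2` a `(k-2)`-star is a single uncovered vertex)
        (¬ ∃ w₁ ∈ S.sats, ∃ w₂ ∈ S.sats, w₁ ≠ v ∧ w₂ ≠ v ∧ w₁ ≠ w₂ ∧
            ∃ T' : GStar G, T'.sats.card = k - 2 ∧ T'.verts ⊆ (coverSet P)ᶜ ∧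
              Disjoint T'.verts T.verts ∧
              G.Adj w₁ T'.center ∧ G.Adj w₂ T'.center))) := by
  have hcov : ∀ {S : GStar G}, S ∈ P → ∀ {v}, v ∈ S.sats → v ∉ (coverSet P)ᶜ :=
    fun hS _ hv h => h (GStar.verts_subset_coverSet hS (GStar.mem_verts_of_mem_sats hv))
  have hcen : ∀ {S : GStar G}, S ∈ P → S.center ∉ (coverSet P)ᶜ := fun hS h =>
    h (GStar.verts_subset_coverSet hS (GStar.center_mem_verts_s2 _))
  refine ⟨fun S hS v hv => ?_, fun S hS hSk v hv u hu hvu hle => ?_, fun S hS hSk => ⟨?_, ?_, ?_⟩⟩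
  · by_contra! hlt
    obtain ⟨T, hTc, hT, hTv⟩ := GStar.exists_of_le_ncard (c := v) (m := k)
      (Set.inter_subset_left (s := G.neighborSet v) (t := (coverSet P)ᶜ)) (by omega)
    have hTU : T.verts ⊆ insert v (coverSet P)ᶜ :=
      hTv.trans (Set.insert_subset_insert Set.inter_subset_right)
    obtain hSk | hSk := (hP.1 S hS).eq_or_lt'
    · have hcT : S.center ∉ T.verts := fun h => (hTU h).elim
        (fun h => S.center_not_mem (h ▸ hv)) (hcen hS)
      obtain ⟨A, -, hA, hAv⟩ := T.exists_insert hcT (hTc ▸ S.adj v hv)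
      refine (h3 S hS hSk).1 ⟨A, by omega, ?_⟩
      rw [hAv]
      have := S.center_mem_verts_s2
      have := GStar.mem_verts_of_mem_sats hv
      grind
    · exact h2 S hS hSk v hv ⟨T, hT.ge, hTU⟩
  · obtain ⟨T, hTc, hT, hTv⟩ := GStar.exists_of_le_ncard (c := u)
      (Set.inter_subset_left (t := (coverSet P)ᶜ)) hle
    have hTU : T.verts ⊆ (coverSet P)ᶜ :=
      hTv.trans (Set.insert_subset hu Set.inter_subset_right)
    obtain ⟨A, -, hA, hAv⟩ := T.exists_insert (fun h => hcov hS hv (hTU h)) (hTc ▸ hvu)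
    exact h2 S hS hSk v hv ⟨A, by omega, hAv ▸ Set.insert_subset_insert hTU⟩
  · rintro ⟨v₁, hv₁, v₂, hv₂, hne, u, hu, hvu₁, hvu₂, hle⟩
    obtain ⟨T, hTc, hT, hTv⟩ := GStar.exists_of_le_ncard (c := u)
      (Set.inter_subset_left (t := (coverSet P)ᶜ)) hle
    have hTU : T.verts ⊆ (coverSet P)ᶜ :=
      hTv.trans (Set.insert_subset hu Set.inter_subset_right)
    obtain ⟨A, hAc, hA, hAv⟩ := T.exists_insert (fun h => hcov hS hv₁ (hTU h)) (hTc ▸ hvu₁)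
    have hv₂A : v₂ ∉ A.verts := by
      rw [hAv]
      exact fun h => h.elim hne.symm fun h => hcov hS hv₂ (hTU h)
    obtain ⟨B, -, hB, hBv⟩ := A.exists_insert hv₂A (hAc ▸ hTc ▸ hvu₂)
    refine (h3 S hS hSk).1 ⟨B, by omega, ?_⟩
    rw [hBv, hAv]
    have := GStar.mem_verts_of_mem_sats hv₁
    have := GStar.mem_verts_of_mem_sats hv₂
    grind
  · rintro ⟨v₁, hv₁, v₂, hv₂, hne, T₁, T₂, hT₁, hT₂, hdisj, hTU₁, hTU₂, hvT₁, hvT₂⟩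
    have hc₁ := hcov hS hv₁
    have hc₂ := hcov hS hv₂
    obtain ⟨A, -, hA, hAv⟩ := T₁.exists_insert (fun h => hc₁ (hTU₁ h)) hvT₁
    obtain ⟨B, -, hB, hBv⟩ := T₂.exists_insert (fun h => hc₂ (hTU₂ h)) hvT₂
    have := GStar.mem_verts_of_mem_sats hv₁
    have := GStar.mem_verts_of_mem_sats hv₂
    refine (h3 S hS hSk).2 ⟨A, B, by omega, by omega, ?_, ?_, ?_⟩
    · rw [Set.disjoint_left] at hdisj ⊢
      grind
    all_goals grind
  · intro v hv T hT hTU hvT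
    have hcv := hcov hS hv
    have := GStar.mem_verts_of_mem_sats hv
    obtain ⟨A, -, hA, hAv⟩ := T.exists_insert (fun h => hcv (hTU h)) hvT
    constructor
    · intro w hw hwv hle
      have hcw := hcov hS hw
      have hcc := hcen hS
      have hwc := (S.adj w hw).ne
      have hvc := (S.adj v hv).ne
      have := GStar.mem_verts_of_mem_sats hw
      have := S.center_mem_verts_s2
      obtain ⟨R, hRc, hR, hRv⟩ := GStar.exists_of_le_ncard (c := w)
        (Set.sdiff_subset.trans Set.inter_subset_left) hle
      have hcR : S.center ∉ R.verts := by grind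
      obtain ⟨B, -, hB, hBv⟩ := R.exists_insert hcR (hRc ▸ S.adj w hw)
      refine (h3 S hS hSk).2 ⟨A, B, by omega, by omega, ?_, ?_, ?_⟩
      · rw [Set.disjoint_left]
        grind
      all_goals grind
    · rintro ⟨w₁, hw₁, w₂, hw₂, hwv₁, hwv₂, hne, T', hT', hTU', hdisj, hwT₁, hwT₂⟩
      have hc₁ := hcov hS hw₁
      have hc₂ := hcov hS hw₂
      have := GStar.mem_verts_of_mem_sats hw₁
      have := GStar.mem_verts_of_mem_sats hw₂
      obtain ⟨C, hCc, hC, hCv⟩ := T'.exists_insert (fun h => hc₁ (hTU' h)) hwT₁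
      have hw₂C : w₂ ∉ C.verts := by grind
      obtain ⟨B, -, hB, hBv⟩ := C.exists_insert hw₂C (hCc ▸ hwT₂)
      refine (h3 S hS hSk).2 ⟨A, B, by omega, by omega, ?_, ?_, ?_⟩
      · rw [Set.disjoint_left] at hdisj ⊢
        grind
      all_goals grind
end

section
/- Let k ≥ 2 be an integer, let G be a finite simple graph, and let P be a k^+-star packing of G satisfying conditions (C1), (C2) and (C3). Then for every k^+-star packing Q of G, every star of Q has at most k−1 of its satellites uncovered by P; consequently every star of Q contains at most k vertices uncovered by P, and if exactly k then its center is uncovered by P. -/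
open SimpleGraph

variable {V : Type*}

/-- Under (C1)–(C3), every star has fewer than `k` satellites uncovered by `P`. -/
theorem ncard_sats_inter_compl_coverSet_lt [Fintype V] {G : SimpleGraph V} {k : ℕ} (hk : 1 ≤ k)
    {P : Set (GStar G)} (hP : IsKPlusPacking k P)
    (h1 : CondC1 k P) (h2 : CondC2 k P) (h3 : CondC3 k P) (S : GStar G) :
    ((↑S.sats : Set V) ∩ (coverSet P)ᶜ).ncard < k := by
  classical
  by_contra! hcard
  let F : Finset V := S.sats.filter (· ∈ (coverSet P)ᶜ)
  have hF : (↑F : Set V) = ↑S.sats ∩ (coverSet P)ᶜ := by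
    ext x
    simp [F]
  have hmem : ∀ x ∈ F, x ∈ S.sats ∧ x ∈ (coverSet P)ᶜ := fun x hx => Finset.mem_filter.mp hx
  rw [← hF, Set.ncard_coe_finset] at hcard
  by_cases hc : S.center ∈ (coverSet P)ᶜ
  · have hsub : (↑F : Set V) ⊆ G.neighborSet S.center ∩ (coverSet P)ᶜ :=
      fun x hx => ⟨S.adj x (hmem x hx).1, (hmem x hx).2⟩
    have hle := Set.ncard_le_ncard hsub (Set.toFinite _)
    rw [Set.ncard_coe_finset] at hle
    have := (h1 _ hc).1
    omega
  · obtain ⟨T, hT, hcT⟩ : ∃ T ∈ P, S.center ∈ T.verts := by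
      simpa [coverSet] using hc
    have hTC : T.center ∉ (coverSet P)ᶜ := fun h =>
      h (Set.mem_biUnion hT (Set.mem_insert _ _))
    rcases hcT with hcT | hcT
    · obtain ⟨u, hu⟩ := Finset.card_pos.mp (by omega : 0 < F.card)
      exact (h1 u (hmem u hu).2).2 T hT (hcT ▸ (S.adj u (hmem u hu).1).symm)
    · rcases (hP.1 T hT).lt_or_eq with hlt | heq
      · refine h2 T hT hlt S.center hcT ⟨⟨S.center, F, fun h => hc (hmem _ h).2,
          fun x hx => S.adj x (hmem x hx).1⟩, hcard, ?_⟩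
        exact Set.insert_subset_insert fun x hx => (hmem x hx).2
      · refine (h3 T hT heq.symm).1 ⟨⟨S.center, insert T.center F, ?_, ?_⟩, ?_, ?_⟩
        · intro h
          rcases Finset.mem_insert.mp h with h | h
          · exact T.center_not_mem (h ▸ hcT)
          · exact hc (hmem _ h).2
        · intro x hx
          rcases Finset.mem_insert.mp hx with rfl | hx
          · exact (T.adj _ hcT).symm
          · exact S.adj x (hmem x hx).1
        · rw [Finset.card_insert_of_notMem fun h => hTC (hmem _ h).2]
          omega
        · rintro x (rfl | hx)
          · exact Or.inl (Or.inr hcT)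
          · rcases Finset.mem_insert.mp hx with rfl | hx
            · exact Or.inl (Or.inl rfl)
            · exact Or.inr (hmem x hx).2

/-- Lemma 3 of the paper: under (C1)–(C3), every star of any `k⁺`-star packing `Q` has at
most `k-1` of its satellites uncovered by `P`; consequently it contains at most `k`
uncovered vertices, and if exactly `k` then its center is uncovered. -/
theorem kplus_few_uncovered_satellites [Fintype V] (G : SimpleGraph V) (k : ℕ) (hk : 2 ≤ k)
    (P : Set (GStar G)) (hP : IsKPlusPacking k P)
    (h1 : CondC1 k P) (h2 : CondC2 k P) (h3 : CondC3 k P) :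
    ∀ Q : Set (GStar G), IsKPlusPacking k Q → ∀ S ∈ Q,
      ((↑S.sats : Set V) ∩ (coverSet P)ᶜ).ncard ≤ k - 1 ∧
      (S.verts ∩ (coverSet P)ᶜ).ncard ≤ k ∧
      ((S.verts ∩ (coverSet P)ᶜ).ncard = k → S.center ∈ (coverSet P)ᶜ) := by
  intro Q _ S _
  have hlt := ncard_sats_inter_compl_coverSet_lt (by omega) hP h1 h2 h3 S
  by_cases hc : S.center ∈ (coverSet P)ᶜ
  · have hle : (S.verts ∩ (coverSet P)ᶜ).ncard ≤ ((↑S.sats : Set V) ∩ (coverSet P)ᶜ).ncard + 1 := by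
      rw [GStar.verts, Set.insert_inter_of_mem hc]
      exact Set.ncard_insert_le _ _
    exact ⟨by omega, by omega, fun _ => hc⟩
  · have heq : S.verts ∩ (coverSet P)ᶜ = ↑S.sats ∩ (coverSet P)ᶜ := by
      rw [GStar.verts, Set.insert_inter_of_notMem hc]
    rw [heq]
    exact ⟨by omega, by omega, fun h => by omega⟩
end

section
/- Let k ≥ 2 be an integer, let G be a finite simple graph, and let P and Q be k^+-star packings of G. For i = 1, 2, let Opt_i be the total number of vertices lying in stars of Q that have exactly k−i+1 vertices uncovered by P, and let Apx_i be the number of those vertices that are covered by P; let Opt_3 be the total number of vertices lying in stars of Q that have at most k−2 vertices uncovered by P, and Apx_3 the number of those vertices covered by P. Then Opt_i ≤ ((k+1)/i)·Apx_i for each i = 1, 2, 3. -/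
open SimpleGraph

variable {V : Type*}

instance GStar.finite [Finite V] (G : SimpleGraph V) : Finite (GStar G) := by
  refine Finite.of_injective (fun S : GStar G => (S.center, S.sats)) ?_
  rintro ⟨c, s, _, _⟩ ⟨d, t, _, _⟩ h
  simp only [Prod.mk.injEq] at h
  obtain ⟨rfl, rfl⟩ := h
  rfl

theorem GStar.ncard_verts {G : SimpleGraph V} (S : GStar G) :
    S.verts.ncard = S.sats.card + 1 := by
  rw [GStar.verts, Set.ncard_insert_of_notMem (by simpa using S.center_not_mem),
    Set.ncard_coe_finset]

theorem Set.Finite.mul_ncard_biUnion_le {α ι : Type*} [Finite α] {R : Set ι} (hR : R.Finite)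
    {f : ι → Set α} {C : Set α} {a b : ℕ} (hdisj : R.PairwiseDisjoint f)
    (h : ∀ i ∈ R, a * (f i).ncard ≤ b * (f i ∩ C).ncard) :
    a * (⋃ i ∈ R, f i).ncard ≤ b * ((⋃ i ∈ R, f i) ∩ C).ncard := by
  induction R, hR using Set.Finite.induction_on with
  | empty => simp
  | @insert i R hi _ ih =>
    have hd : Disjoint (f i) (⋃ j ∈ R, f j) := by
      simp only [Set.disjoint_iUnion_right]
      intro j hj
      exact hdisj (Set.mem_insert i R) (Set.mem_insert_of_mem i hj) (by rintro rfl; exact hi hj)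
    rw [Set.biUnion_insert, Set.union_inter_distrib_right, Set.ncard_union_eq hd,
      Set.ncard_union_eq (hd.mono Set.inter_subset_left Set.inter_subset_left), mul_add, mul_add]
    exact add_le_add (h i (Set.mem_insert i R))
      (ih (hdisj.subset (Set.subset_insert i R)) fun j hj => h j (Set.mem_insert_of_mem i hj))

theorem GStar.mul_ncard_verts_le [Finite V] {G : SimpleGraph V} {S : GStar G} {C : Set V}
    {k i : ℕ} (hk : k ≤ S.sats.card) (hi : (S.verts ∩ Cᶜ).ncard + i ≤ k + 1) :
    i * S.verts.ncard ≤ (k + 1) * (S.verts ∩ C).ncard := by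
  have hs := S.ncard_verts
  have hu := Set.ncard_inter_add_ncard_sdiff_eq_ncard S.verts C
  rw [Set.sdiff_eq] at hu
  generalize (S.verts ∩ C).ncard = c at *
  generalize (S.verts ∩ Cᶜ).ncard = u at *
  obtain ⟨d, hd⟩ := Nat.exists_eq_add_of_le hi
  obtain ⟨e, he⟩ := Nat.exists_eq_add_of_le hk
  have hc : c = i + d + e := by omega
  rw [hs, he, hc, hd, show k + e + 1 = u + i + d + e by omega]
  nlinarith [Nat.zero_le (u * d), Nat.zero_le (u * e), Nat.zero_le (d * e),
    Nat.zero_le (i * d), Nat.zero_le (d * d)]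

theorem IsKPlusPacking.ncard_biUnion_le [Finite V] {G : SimpleGraph V} {k i : ℕ} (h0 : 0 < i)
    {Q : Set (GStar G)} (hQ : IsKPlusPacking k Q) (C : Set V) (p : GStar G → Prop)
    (hp : ∀ S, p S → (S.verts ∩ Cᶜ).ncard + i ≤ k + 1) :
    ((⋃ S ∈ {S ∈ Q | p S}, GStar.verts S).ncard : ℝ) ≤
      (((k : ℝ) + 1) / i) * (((⋃ S ∈ {S ∈ Q | p S}, GStar.verts S) ∩ C).ncard : ℝ) := by
  have h := (Set.toFinite {S ∈ Q | p S}).mul_ncard_biUnion_le (f := GStar.verts) (C := C)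
    (a := i) (b := k + 1) (fun S hS T hT hST => hQ.2 hS.1 hT.1 hST)
    (fun S hS => GStar.mul_ncard_verts_le (hQ.1 S hS.1) (hp S hS.2))
  rw [div_mul_eq_mul_div, le_div_iff₀' (by exact_mod_cast h0)]
  exact_mod_cast h

/-- Equation (2) of the paper: for `k⁺`-star packings `P` and `Q`, letting `Opt_i` be the
number of vertices in Type-`i` stars of `Q` (those with exactly `k-i+1` uncovered
vertices for `i = 1, 2`, and at most `k-2` uncovered vertices for `i = 3`) and `Apx_i`
the number of those covered by `P`, we have `Opt_i ≤ ((k+1)/i)·Apx_i`. -/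
theorem type_counting_bounds [Fintype V] (G : SimpleGraph V) (k : ℕ) (hk : 2 ≤ k)
    (P Q : Set (GStar G)) (hP : IsKPlusPacking k P) (hQ : IsKPlusPacking k Q) :
    (((⋃ S ∈ {S ∈ Q | (S.verts ∩ (coverSet P)ᶜ).ncard = k}, GStar.verts S).ncard : ℝ) ≤
      (((k : ℝ) + 1) / 1) *
        (((⋃ S ∈ {S ∈ Q | (S.verts ∩ (coverSet P)ᶜ).ncard = k}, GStar.verts S) ∩
            coverSet P).ncard : ℝ)) ∧
    (((⋃ S ∈ {S ∈ Q | (S.verts ∩ (coverSet P)ᶜ).ncard = k - 1}, GStar.verts S).ncard : ℝ) ≤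
      (((k : ℝ) + 1) / 2) *
        (((⋃ S ∈ {S ∈ Q | (S.verts ∩ (coverSet P)ᶜ).ncard = k - 1}, GStar.verts S) ∩
            coverSet P).ncard : ℝ)) ∧
    (((⋃ S ∈ {S ∈ Q | (S.verts ∩ (coverSet P)ᶜ).ncard ≤ k - 2}, GStar.verts S).ncard : ℝ) ≤
      (((k : ℝ) + 1) / 3) *
        (((⋃ S ∈ {S ∈ Q | (S.verts ∩ (coverSet P)ᶜ).ncard ≤ k - 2}, GStar.verts S) ∩
            coverSet P).ncard : ℝ)) := by
  refine ⟨?_, ?_, ?_⟩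
  · exact_mod_cast hQ.ncard_biUnion_le one_pos (coverSet P)
      (fun S => (S.verts ∩ (coverSet P)ᶜ).ncard = k) fun S hS => by omega
  · exact_mod_cast hQ.ncard_biUnion_le two_pos (coverSet P)
      (fun S => (S.verts ∩ (coverSet P)ᶜ).ncard = k - 1) fun S hS => by omega
  · exact_mod_cast hQ.ncard_biUnion_le three_pos (coverSet P)
      (fun S => (S.verts ∩ (coverSet P)ᶜ).ncard ≤ k - 2) fun S hS => by omega
end

section
/- Let k ≥ 2 be an integer and let O1, O2, O3, A1, A2, A3, A4 be nonnegative real numbers satisfying O_i ≤ ((k+1)/i)·A_i for i = 1, 2, 3, and k·A1 ≤ (1/2)·A2 + A3 + A4. Then O1 + O2 + O3 ≤ (1 + k^2/(2k+1))·(A1 + A2 + A3 + A4). (This is the arithmetic core of the proof of the (1 + k^2/(2k+1))-approximation guarantee for k^+-star packing.) -/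
/-- The arithmetic core of the `(1 + k²/(2k+1))`-approximation guarantee for `k⁺`-star
packing. -/
theorem kplus_ratio_arith (k : ℕ) (hk : 2 ≤ k)
    (O1 O2 O3 A1 A2 A3 A4 : ℝ)
    (hO1 : 0 ≤ O1) (hO2 : 0 ≤ O2) (hO3 : 0 ≤ O3)
    (hA1 : 0 ≤ A1) (hA2 : 0 ≤ A2) (hA3 : 0 ≤ A3) (hA4 : 0 ≤ A4)
    (h1 : O1 ≤ (((k : ℝ) + 1) / 1) * A1)
    (h2 : O2 ≤ (((k : ℝ) + 1) / 2) * A2)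
    (h3 : O3 ≤ (((k : ℝ) + 1) / 3) * A3)
    (h4 : (k : ℝ) * A1 ≤ (1 / 2) * A2 + A3 + A4) :
    O1 + O2 + O3 ≤ (1 + (k : ℝ) ^ 2 / (2 * (k : ℝ) + 1)) * (A1 + A2 + A3 + A4) := by
  have hk' : (2 : ℝ) ≤ k := by exact_mod_cast hk
  have hpos : (0 : ℝ) < 2 * k + 1 := by linarith
  have hratio : 1 + (k : ℝ) ^ 2 / (2 * k + 1) = (k + 1) ^ 2 / (2 * k + 1) := by
    field_simp
    ring
  have hbound : O1 + O2 + O3 ≤ ((k : ℝ) + 1) * (A1 + A2 / 2 + A3 / 3) := by linarith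
  have hA : (A1 + A2 / 2 + A3 / 3) * (2 * (k : ℝ) + 1) ≤ (k + 1) * (A1 + A2 + A3 + A4) := by
    linarith [mul_nonneg (sub_nonneg.2 hk') hA3, mul_nonneg (sub_nonneg.2 hk') hA4]
  rw [hratio, div_mul_eq_mul_div, le_div_iff₀ hpos]
  calc (O1 + O2 + O3) * (2 * (k : ℝ) + 1)
      ≤ (k + 1) * (A1 + A2 / 2 + A3 / 3) * (2 * k + 1) := by gcongr
    _ = (k + 1) * ((A1 + A2 / 2 + A3 / 3) * (2 * k + 1)) := by ring
    _ ≤ (k + 1) * ((k + 1) * (A1 + A2 + A3 + A4)) := by gcongr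
    _ = (k + 1) ^ 2 * (A1 + A2 + A3 + A4) := by ring
end

section
/- Let G be a finite simple graph with vertex set V, let k > t ≥ 2 be integers, and let Q* be an optimal k^−/t-star packing of G. Then there exists an optimal k^−-star packing Q0 of G such that every vertex uncovered by Q0 is also uncovered by Q*, i.e., V ∖ V(Q0) ⊆ V ∖ V(Q*). -/
open SimpleGraph

variable {V : Type*}

/-- A `k⁻`-star packing: pairwise vertex-disjoint `ℓ`-stars with `1 ≤ ℓ ≤ k`. -/
def IsKMinusPacking {G : SimpleGraph V} (k : ℕ) (Q : Set (GStar G)) : Prop :=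
  (∀ S ∈ Q, 1 ≤ S.sats.card ∧ S.sats.card ≤ k) ∧
  Q.Pairwise fun S T => Disjoint S.verts T.verts

/-- An optimal `k⁻`-star packing: one covering the maximum possible number of vertices. -/
def IsOptimalKMinusPacking {G : SimpleGraph V} (k : ℕ) (Q : Set (GStar G)) : Prop :=
  IsKMinusPacking k Q ∧
  ∀ Q' : Set (GStar G), IsKMinusPacking k Q' → (coverSet Q').ncard ≤ (coverSet Q).ncard

/-- A `k⁻/t`-star packing: pairwise vertex-disjoint `ℓ`-stars with `1 ≤ ℓ ≤ k`, `ℓ ≠ t`. -/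
def IsKtPacking {G : SimpleGraph V} (k t : ℕ) (Q : Set (GStar G)) : Prop :=
  (∀ S ∈ Q, 1 ≤ S.sats.card ∧ S.sats.card ≤ k ∧ S.sats.card ≠ t) ∧
  Q.Pairwise fun S T => Disjoint S.verts T.verts

/-- An optimal `k⁻/t`-star packing. -/
def IsOptimalKtPacking {G : SimpleGraph V} (k t : ℕ) (Q : Set (GStar G)) : Prop :=
  IsKtPacking k t Q ∧
  ∀ Q' : Set (GStar G), IsKtPacking k t Q' → (coverSet Q').ncard ≤ (coverSet Q).ncard

/-- A legal star for a `k⁻`-packing: `1 ≤ ℓ ≤ k` satellites. -/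
def OkStar {G : SimpleGraph V} (k : ℕ) (S : GStar G) : Prop :=
  1 ≤ S.sats.card ∧ S.sats.card ≤ k

/-- `W` can be partitioned into the vertex sets of two vertex-disjoint `ℓ`-stars of `G`
with `1 ≤ ℓ ≤ k`, neither of which has exactly `t` satellites. -/
def SplitsInto2NoT (G : SimpleGraph V) (k t : ℕ) (W : Set V) : Prop :=
  ∃ A B : GStar G, OkStar k A ∧ OkStar k B ∧ A.sats.card ≠ t ∧ B.sats.card ≠ t ∧
    Disjoint A.verts B.verts ∧ A.verts ∪ B.verts = W

/-- `W` can be partitioned into the vertex sets of three pairwise vertex-disjoint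
`ℓ`-stars of `G` with `1 ≤ ℓ ≤ k`, at most one of which has exactly `t` satellites. -/
def SplitsInto3AtMostOneT (G : SimpleGraph V) (k t : ℕ) (W : Set V) : Prop :=
  ∃ A B C : GStar G, OkStar k A ∧ OkStar k B ∧ OkStar k C ∧
    Disjoint A.verts B.verts ∧ Disjoint A.verts C.verts ∧ Disjoint B.verts C.verts ∧
    A.verts ∪ B.verts ∪ C.verts = W ∧
    ¬(A.sats.card = t ∧ B.sats.card = t) ∧ ¬(A.sats.card = t ∧ C.sats.card = t) ∧
    ¬(B.sats.card = t ∧ C.sats.card = t)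

/-- `W` can be partitioned into the vertex sets of three pairwise vertex-disjoint
`ℓ`-stars of `G` with `1 ≤ ℓ ≤ k`, none of which has exactly `t` satellites. -/
def SplitsInto3NoT (G : SimpleGraph V) (k t : ℕ) (W : Set V) : Prop :=
  ∃ A B C : GStar G, OkStar k A ∧ OkStar k B ∧ OkStar k C ∧
    A.sats.card ≠ t ∧ B.sats.card ≠ t ∧ C.sats.card ≠ t ∧
    Disjoint A.verts B.verts ∧ Disjoint A.verts C.verts ∧ Disjoint B.verts C.verts ∧
    A.verts ∪ B.verts ∪ C.verts = W

/-- A `k⁻`-star packing `Q0` is Revise-stable (conditions (R1), (R2), (R3)). -/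
def ReviseStable (G : SimpleGraph V) (k t : ℕ) (Q0 : Set (GStar G)) : Prop :=
  (3 ≤ t → ∀ S ∈ Q0, S.sats.card = t →
    ¬ ∃ A B : GStar G, A.sats.card = t - 2 ∧ B.sats.card = 1 ∧
        Disjoint A.verts B.verts ∧ A.verts ∪ B.verts = S.verts) ∧
  (∀ S ∈ Q0, S.sats.card = t → ∀ S' ∈ Q0, S' ≠ S →
    ¬ SplitsInto2NoT G k t (S.verts ∪ S'.verts) ∧
    ¬ SplitsInto3AtMostOneT G k t (S.verts ∪ S'.verts)) ∧
  (∀ S ∈ Q0, ∀ T ∈ Q0, S ≠ T → S.sats.card = t → T.sats.card = t →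
    ∀ S' ∈ Q0, S' ≠ S → S' ≠ T →
      (S'.sats.card = 1 ∨ S'.sats.card = t - 1 ∨ S'.sats.card = t + 1) →
      ¬ SplitsInto2NoT G k t (S.verts ∪ T.verts ∪ S'.verts) ∧
      ¬ SplitsInto3NoT G k t (S.verts ∪ T.verts ∪ S'.verts))

section Hall

variable {α β : Type*} [DecidableEq β]

/-- The `k`-fold Hall condition on `W` for the set family `N`. -/
def HallCondition (k : ℕ) (N : α → Finset β) (W : Finset α) : Prop :=
  ∀ X ⊆ W, X.card ≤ k * (X.biUnion N).card

theorem HallCondition.mono {k : ℕ} {N : α → Finset β} {W W' : Finset α}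
    (h : HallCondition k N W) (hW : W' ⊆ W) : HallCondition k N W' :=
  fun X hX => h X (hX.trans hW)

theorem hallCondition_of_fiber_card_le {k : ℕ} {N : α → Finset β} {W : Finset α} (f : α → β)
    (hf : ∀ w ∈ W, f w ∈ N w) (hk : ∀ u, (W.filter fun w => f w = u).card ≤ k) :
    HallCondition k N W := by
  intro X hX
  have h1 : X.card ≤ k * (X.image f).card :=
    Finset.card_le_mul_card_image X k fun u _ =>
      (Finset.card_le_card (Finset.filter_subset_filter _ hX)).trans (hk u)
  have h2 : X.image f ⊆ X.biUnion N := by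
    intro u hu
    obtain ⟨x, hx, rfl⟩ := Finset.mem_image.1 hu
    exact Finset.mem_biUnion.2 ⟨x, hx, hf x (hX hx)⟩
  exact h1.trans (Nat.mul_le_mul_left _ (Finset.card_le_card h2))

variable [DecidableEq α]

theorem HallCondition.exists_fiber_card_le {k : ℕ} {N : α → Finset α} {W : Finset α}
    (h : HallCondition k N W) :
    ∃ f : α → α, (∀ w ∈ W, f w ∈ N w) ∧ ∀ u, (W.filter fun w => f w = u).card ≤ k := by
  have hall : ∀ s : Finset W,
      s.card ≤ (s.biUnion fun w => N w ×ˢ (Finset.univ : Finset (Fin k))).card := by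
    intro s
    have h1 := h (s.map (Function.Embedding.subtype _)) (by
      intro x hx
      obtain ⟨y, _, rfl⟩ := Finset.mem_map.1 hx
      exact y.2)
    have h2 : (s.biUnion fun w => N w ×ˢ (Finset.univ : Finset (Fin k))) =
        (s.map (Function.Embedding.subtype _)).biUnion N ×ˢ (Finset.univ : Finset (Fin k)) := by
      ext ⟨a, i⟩
      simp
    rw [h2, Finset.card_product, Finset.card_univ, Fintype.card_fin, mul_comm]
    simpa using h1
  obtain ⟨g, hginj, hg⟩ :=
    (Finset.all_card_le_biUnion_card_iff_exists_injective _).1 hall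
  refine ⟨fun w => if hw : w ∈ W then (g ⟨w, hw⟩).1 else w, ?_, ?_⟩
  · intro w hw
    have := hg ⟨w, hw⟩
    simp only [hw, dite_true]
    exact (Finset.mem_product.1 this).1
  · intro u
    have : ((W.filter fun w => (if hw : w ∈ W then (g ⟨w, hw⟩).1 else w) = u)).card ≤
        (({u} : Finset α) ×ˢ (Finset.univ : Finset (Fin k))).card := by
      refine Finset.card_le_card_of_forall_subsingleton
        (fun w p => ∃ hw : w ∈ W, g ⟨w, hw⟩ = p) ?_ ?_
      · intro w hw
        obtain ⟨hwW, hwu⟩ := Finset.mem_filter.1 hw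
        simp only [hwW, dite_true] at hwu
        exact ⟨g ⟨w, hwW⟩, Finset.mem_product.2 ⟨Finset.mem_singleton.2 hwu, Finset.mem_univ _⟩,
        hwW, rfl⟩
      · rintro p - a ⟨-, ha, ha'⟩ b ⟨-, hb, hb'⟩
        exact congrArg Subtype.val (hginj (ha'.trans hb'.symm))
    simpa using this

/-- Tight subsets of a set satisfying the Hall condition are closed under union. -/
theorem HallCondition.tight_union {k : ℕ} {N : α → Finset β} {W S T : Finset α}
    (h : HallCondition k N W) (hS : S ⊆ W)
    (hSt : k * (S.biUnion N).card ≤ S.card) (hTt : k * (T.biUnion N).card ≤ T.card) :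
    k * ((S ∪ T).biUnion N).card ≤ (S ∪ T).card := by
  have h1 := h (S ∩ T) (Finset.inter_subset_left.trans hS)
  have h2 : ((S ∩ T).biUnion N).card ≤ (S.biUnion N ∩ T.biUnion N).card := by
    refine Finset.card_le_card (Finset.subset_inter ?_ ?_)
    · exact Finset.biUnion_subset_biUnion_of_subset_left _ Finset.inter_subset_left
    · exact Finset.biUnion_subset_biUnion_of_subset_left _ Finset.inter_subset_right
  have h3 : (S ∪ T).biUnion N = S.biUnion N ∪ T.biUnion N := Finset.union_biUnion
  have h4 := Finset.card_union_add_card_inter (S.biUnion N) (T.biUnion N)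
  have h5 := Finset.card_union_add_card_inter S T
  rw [h3]
  nlinarith

/-- An inclusion-maximal set satisfying the Hall condition has maximum cardinality. -/
theorem HallCondition.card_le_of_maximal {k : ℕ} (hk : 0 < k) {N : α → Finset β}
    {A B : Finset α} (hA : HallCondition k N A)
    (hmax : ∀ b ∉ A, ¬ HallCondition k N (insert b A)) (hB : HallCondition k N B) :
    B.card ≤ A.card := by
  have hT : ∃ T ∈ A.powerset.filter fun T => k * (T.biUnion N).card ≤ T.card,
      ∀ S ∈ A.powerset.filter fun T => k * (T.biUnion N).card ≤ T.card, S.card ≤ T.card :=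
    Finset.exists_max_image _ _ ⟨∅, by simp⟩
  simp only [Finset.mem_filter, Finset.mem_powerset] at hT
  obtain ⟨T, ⟨hTA, hTt⟩, hTmax⟩ := hT
  have hN : ∀ b ∈ B \ A, N b ⊆ T.biUnion N := by
    intro b hb
    have hbA := (Finset.mem_sdiff.1 hb).2
    have hfail := hmax b hbA
    simp only [HallCondition, not_forall, not_le] at hfail
    obtain ⟨X, hX, hXc⟩ := hfail
    have hbX : b ∈ X := by
      by_contra hbX
      exact absurd (hA X ((Finset.subset_insert_iff_of_notMem hbX).1 hX)) (not_le.2 hXc)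
    have hXA : X.erase b ⊆ A := Finset.subset_insert_iff.1 hX
    have hcard := Finset.card_erase_add_one hbX
    have hsub : (X.erase b).biUnion N ⊆ X.biUnion N :=
      Finset.biUnion_subset_biUnion_of_subset_left _ (Finset.erase_subset _ _)
    have hle : k * (X.biUnion N).card ≤ k * ((X.erase b).biUnion N).card := by
      have := hA _ hXA
      omega
    have heq := Finset.eq_of_subset_of_card_le hsub (Nat.le_of_mul_le_mul_left hle hk)
    have htight : k * ((X.erase b).biUnion N).card ≤ (X.erase b).card := by
      rw [heq]; omega
    have hunion := hTmax _ ⟨Finset.union_subset hTA hXA, hA.tight_union hTA hTt htight⟩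
    have hTeq := Finset.eq_of_subset_of_card_le Finset.subset_union_left hunion
    have hsubT : X.erase b ⊆ T := by
      rw [hTeq]; exact Finset.subset_union_right
    calc N b ⊆ X.biUnion N := Finset.subset_biUnion_of_mem N hbX
      _ = (X.erase b).biUnion N := heq.symm
      _ ⊆ T.biUnion N := Finset.biUnion_subset_biUnion_of_subset_left _ hsubT
  have h1 := hB ((B \ A) ∪ (B ∩ T))
    (Finset.union_subset Finset.sdiff_subset Finset.inter_subset_left)
  have h2 : ((B \ A) ∪ (B ∩ T)).biUnion N ⊆ T.biUnion N := by
    intro v hv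
    obtain ⟨x, hx, hxv⟩ := Finset.mem_biUnion.1 hv
    rcases Finset.mem_union.1 hx with hx | hx
    · exact hN x hx hxv
    · exact Finset.mem_biUnion.2 ⟨x, (Finset.mem_inter.1 hx).2, hxv⟩
  have h3 : B ⊆ ((B \ A) ∪ (B ∩ T)) ∪ (A \ T) := by
    intro x hx
    simp only [Finset.mem_union, Finset.mem_sdiff, Finset.mem_inter]
    tauto
  have h4 := (Finset.card_le_card h3).trans (Finset.card_union_le _ _)
  have h5 := Nat.mul_le_mul_left k (Finset.card_le_card h2)
  have h6 := Finset.card_sdiff_add_card_eq_card hTA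
  omega

end Hall

section StarMap

open Classical in
/-- A map sending each satellite of a `k⁻`-star packing to its center and fixing every other
vertex. -/
def IsStarMap [Fintype V] (G : SimpleGraph V) (k : ℕ) (c : V → V) : Prop :=
  (∀ v, c (c v) = c v) ∧ (∀ v, c v ≠ v → G.Adj (c v) v) ∧
    ∀ u, (Finset.univ.filter fun v => c v = u ∧ v ≠ u).card ≤ k

/-- The vertices covered by the stars of a star map. -/
def starMapCover (c : V → V) : Set V :=
  {v | c v ≠ v ∨ ∃ d, d ≠ v ∧ c d = v}

open Classical in
theorem exists_packing_of_isStarMap [Fintype V] {G : SimpleGraph V} {k : ℕ} {c : V → V}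
    (hc : IsStarMap G k c) :
    ∃ P : Set (GStar G), IsKMinusPacking k P ∧ starMapCover c ⊆ coverSet P := by
  obtain ⟨hidem, hadj, hcard⟩ := hc
  let star : V → GStar G := fun u =>
    { center := u
      sats := Finset.univ.filter fun v => c v = u ∧ v ≠ u
      center_not_mem := by simp
      adj := by
        intro v hv
        obtain ⟨-, h, hne⟩ := Finset.mem_filter.1 hv
        have := hadj v (by rw [h]; exact hne.symm)
        rwa [h] at this }
  have hverts : ∀ u v, v ∈ (star u).verts ↔ v = u ∨ (c v = u ∧ v ≠ u) := by
    intro u v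
    simp [GStar.verts, star]
  have hmem : ∀ u d, d ≠ u → c d = u → ∀ v, v ∈ (star u).verts → c v = u := by
    intro u d _ hd v hv
    rcases (hverts u v).1 hv with rfl | h
    · rw [← hd, hidem]
    · exact h.1
  refine ⟨star '' {u | ∃ d, d ≠ u ∧ c d = u}, ⟨?_, ?_⟩, ?_⟩
  · rintro _ ⟨u, ⟨d, hdu, hd⟩, rfl⟩
    exact ⟨Finset.card_pos.2 ⟨d, by simp [star, hd, hdu]⟩, hcard u⟩
  · rintro _ ⟨u, ⟨d, hdu, hd⟩, rfl⟩ _ ⟨u', ⟨d', hdu', hd'⟩, rfl⟩ hne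
    refine Set.disjoint_left.2 fun v hv hv' => hne ?_
    rw [← hmem u d hdu hd v hv, ← hmem u' d' hdu' hd' v hv']
  · rintro v (hv | ⟨d, hdv, hd⟩)
    · refine Set.mem_biUnion (Set.mem_image_of_mem _ ⟨v, hv.symm, rfl⟩) ?_
      exact (hverts _ _).2 (Or.inr ⟨rfl, hv.symm⟩)
    · refine Set.mem_biUnion (Set.mem_image_of_mem _ ⟨d, hdv, hd⟩) ?_
      exact (hverts _ _).2 (Or.inl rfl)

end StarMap

open Classical in
theorem hallCondition_coverSet [Fintype V] {G : SimpleGraph V} {k : ℕ}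
    {Q : Set (GStar G)} (hQ : IsKMinusPacking k Q) :
    HallCondition k (fun v => G.neighborFinset v) (coverSet Q).toFinset := by
  obtain ⟨hsize, hdisj⟩ := hQ
  have huniq : ∀ S ∈ Q, ∀ T ∈ Q, ∀ v, v ∈ S.verts → v ∈ T.verts → S = T := by
    intro S hS T hT v hvS hvT
    by_contra hne
    exact Set.disjoint_left.1 (hdisj hS hT hne) hvS hvT
  have hex : ∀ v, ∃ u, v ∈ coverSet Q → ∃ S ∈ Q, v ∈ S.verts ∧ u ∈ S.verts ∧
      ((v = S.center ∧ u ∈ S.sats) ∨ (v ∈ S.sats ∧ u = S.center)) := by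
    intro v
    by_cases hv : v ∈ coverSet Q
    · obtain ⟨S, hS, hvS⟩ := Set.mem_iUnion₂.1 hv
      rcases hvS with h | h
      · obtain ⟨u, hu⟩ := Finset.card_pos.1 (hsize S hS).1
        exact ⟨u, fun _ => ⟨S, hS, Or.inl h, Or.inr hu, Or.inl ⟨h, hu⟩⟩⟩
      · exact ⟨S.center, fun _ => ⟨S, hS, Or.inr h, Or.inl rfl, Or.inr ⟨h, rfl⟩⟩⟩
    · exact ⟨v, fun h => absurd h hv⟩
  choose f hf using hex
  refine hallCondition_of_fiber_card_le f ?_ ?_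
  · intro w hw
    obtain ⟨S, -, -, -, h⟩ := hf w (Set.mem_toFinset.1 hw)
    rw [mem_neighborFinset]
    rcases h with ⟨h1, h2⟩ | ⟨h1, h2⟩
    · have := S.adj _ h2
      rwa [← h1] at this
    · rw [h2]; exact (S.adj _ h1).symm
  · intro u
    rcases Finset.eq_empty_or_nonempty
      ((coverSet Q).toFinset.filter fun w => f w = u) with he | ⟨w₀, hw₀⟩
    · rw [he]; simp
    obtain ⟨hw₀Q, hw₀u⟩ := Finset.mem_filter.1 hw₀
    obtain ⟨S, hS, -, huS, -⟩ := hf w₀ (Set.mem_toFinset.1 hw₀Q)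
    rw [hw₀u] at huS
    have key : ∀ w ∈ (coverSet Q).toFinset.filter fun w => f w = u,
        (w = S.center ∧ u ∈ S.sats) ∨ (w ∈ S.sats ∧ u = S.center) := by
      intro w hw
      obtain ⟨hwQ, hwu⟩ := Finset.mem_filter.1 hw
      obtain ⟨T, hT, -, huT, h⟩ := hf w (Set.mem_toFinset.1 hwQ)
      rw [hwu] at huT h
      rwa [huniq S hS T hT u huS huT]
    by_cases hu : u = S.center
    · refine (Finset.card_le_card fun w hw => ?_).trans (hsize S hS).2
      rcases key w hw with ⟨-, h⟩ | ⟨h, -⟩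
      · exact absurd (hu ▸ h) S.center_not_mem
      · exact h
    · refine (Finset.card_le_card (t := {S.center}) fun w hw => ?_).trans
        ((Finset.card_singleton _).le.trans ((hsize S hS).1.trans (hsize S hS).2))
      rcases key w hw with ⟨h, -⟩ | ⟨-, h⟩
      · exact Finset.mem_singleton.2 h
      · exact absurd h hu

section Augment

open Classical in
theorem IsStarMap.update_of_card_lt [Fintype V] {G : SimpleGraph V} {k : ℕ} {c : V → V}
    (hc : IsStarMap G k c) {w u : V} (hw : w ∉ starMapCover c) (hadj : G.Adj w u)
    (hu : c u = u) (hlt : (Finset.univ.filter fun v => c v = u ∧ v ≠ u).card < k) :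
    IsStarMap G k (Function.update c w u) := by
  obtain ⟨h1, h2, h3⟩ := hc
  have hne := hadj.ne
  simp only [starMapCover, Set.mem_ofPred_eq, not_or, not_exists, not_and, not_not] at hw
  obtain ⟨hw1, hw2⟩ := hw
  refine ⟨fun v => ?_, fun v => ?_, fun x => ?_⟩
  · simp only [Function.update_apply]; grind
  · simp only [Function.update_apply]; grind [SimpleGraph.adj_comm]
  · by_cases hx : x = u
    · subst hx
      refine (Finset.card_le_card (t := insert w
        (Finset.univ.filter fun v => c v = x ∧ v ≠ x)) fun v => ?_).trans
        ((Finset.card_insert_le _ _).trans hlt)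
      simp only [Function.update_apply, Finset.mem_filter, Finset.mem_insert,
        Finset.mem_univ, true_and]
      grind
    · refine (Finset.card_le_card fun v => ?_).trans (h3 x)
      simp only [Function.update_apply, Finset.mem_filter, Finset.mem_univ, true_and]
      grind

open Classical in
/-- Splitting the satellite `u` off its star, to become the center of the edge `uw`. -/
theorem IsStarMap.detach [Fintype V] {G : SimpleGraph V} {k : ℕ} (hk : 1 ≤ k) {c : V → V}
    (hc : IsStarMap G k c) {w u : V} (hw : w ∉ starMapCover c) (hadj : G.Adj w u)
    (hu : c u ≠ u) : IsStarMap G k (Function.update (Function.update c w u) u u) := by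
  obtain ⟨h1, h2, h3⟩ := hc
  have hne := hadj.ne
  simp only [starMapCover, Set.mem_ofPred_eq, not_or, not_exists, not_and, not_not] at hw
  obtain ⟨hw1, hw2⟩ := hw
  refine ⟨fun v => ?_, fun v => ?_, fun x => ?_⟩
  · simp only [Function.update_apply]; grind
  · simp only [Function.update_apply]; grind [SimpleGraph.adj_comm]
  · by_cases hx : x = u
    · subst hx
      refine (Finset.card_le_card (t := {w}) fun v => ?_).trans
        ((Finset.card_singleton _).le.trans hk)
      simp only [Function.update_apply, Finset.mem_filter, Finset.mem_singleton,
        Finset.mem_univ, true_and]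
      grind
    · refine (Finset.card_le_card fun v => ?_).trans (h3 x)
      simp only [Function.update_apply, Finset.mem_filter, Finset.mem_univ, true_and]
      grind

open Classical in
/-- Turning the single-edge star `u → z` into the two-satellite star centered at `u`. -/
theorem IsStarMap.flip [Fintype V] {G : SimpleGraph V} {k : ℕ} (hk : 2 ≤ k) {c : V → V}
    (hc : IsStarMap G k c) {w u : V} (hw : w ∉ starMapCover c) (hadj : G.Adj w u)
    (hu : c u ≠ u) (honly : ∀ d, c d = c u → d ≠ c u → d = u) :
    IsStarMap G k (Function.update (Function.update (Function.update c w u) u u) (c u) u) := by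
  obtain ⟨h1, h2, h3⟩ := hc
  have hne := hadj.ne
  simp only [starMapCover, Set.mem_ofPred_eq, not_or, not_exists, not_and, not_not] at hw
  obtain ⟨hw1, hw2⟩ := hw
  refine ⟨fun v => ?_, fun v => ?_, fun x => ?_⟩
  · simp only [Function.update_apply]; grind
  · simp only [Function.update_apply]; grind [SimpleGraph.adj_comm]
  · by_cases hx : x = u
    · subst hx
      refine (Finset.card_le_card (t := {w, c x}) fun v => ?_).trans
        (Finset.card_le_two.trans hk)
      simp only [Function.update_apply, Finset.mem_filter, Finset.mem_singleton,
        Finset.mem_insert, Finset.mem_univ, true_and]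
      grind
    · refine (Finset.card_le_card fun v => ?_).trans (h3 x)
      simp only [Function.update_apply, Finset.mem_filter, Finset.mem_univ, true_and]
      grind

open Classical in
/-- Replacing the satellite `y` of the star centered at `u` by `w`. -/
theorem IsStarMap.swap [Fintype V] {G : SimpleGraph V} {k : ℕ} {c : V → V}
    (hc : IsStarMap G k c) {w u y : V} (hw : w ∉ starMapCover c) (hadj : G.Adj w u)
    (hu : c u = u) (hy : c y = u) (hyu : y ≠ u) :
    IsStarMap G k (Function.update (Function.update c w u) y y) := by
  obtain ⟨h1, h2, h3⟩ := hc
  have hne := hadj.ne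
  simp only [starMapCover, Set.mem_ofPred_eq, not_or, not_exists, not_and, not_not] at hw
  obtain ⟨hw1, hw2⟩ := hw
  refine ⟨fun v => ?_, fun v => ?_, fun x => ?_⟩
  · simp only [Function.update_apply]; grind
  · simp only [Function.update_apply]; grind [SimpleGraph.adj_comm]
  · by_cases hx : x = u
    · subst hx
      have hymem : y ∈ Finset.univ.filter fun v => c v = x ∧ v ≠ x := by simp [hy, hyu]
      refine (Finset.card_le_card (t := insert w
        ((Finset.univ.filter fun v => c v = x ∧ v ≠ x).erase y)) fun v => ?_).trans
        ((Finset.card_insert_le _ _).trans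
          ((Finset.card_erase_add_one hymem).le.trans (h3 x)))
      simp only [Function.update_apply, Finset.mem_filter, Finset.mem_insert,
        Finset.mem_erase, Finset.mem_univ, true_and]
      grind
    · refine (Finset.card_le_card fun v => ?_).trans (h3 x)
      simp only [Function.update_apply, Finset.mem_filter, Finset.mem_univ, true_and]
      grind

open Classical in
theorem exists_isStarMap_cover [Fintype V] {G : SimpleGraph V} {k : ℕ} (hk : 2 ≤ k)
    {W : Finset V} {f : V → V} (hf : ∀ w ∈ W, G.Adj w (f w))
    (hfk : ∀ u, (W.filter fun w => f w = u).card ≤ k) :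
    ∃ c : V → V, IsStarMap G k c ∧ (W : Set V) ⊆ starMapCover c := by
  -- Maximize coverage of `W` first, then agreement with `f`.
  let cov : (V → V) → Finset V := fun c => W.filter fun v => v ∈ starMapCover c
  let agree : (V → V) → Finset V := fun c => W.filter fun v => c v ≠ v ∧ c v = f v
  have hid : IsStarMap G k (id : V → V) := by
    refine ⟨fun v => rfl, fun v h => absurd rfl h, fun u => ?_⟩
    rw [Finset.filter_false_of_mem]
    · simp
    · rintro v - ⟨h1, h2⟩
      exact h2 h1
  obtain ⟨c, hcmem, hmax⟩ := Finset.exists_max_image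
    (Finset.univ.filter fun c => IsStarMap G k c)
    (fun c => (cov c).card * (W.card + 1) + (agree c).card) ⟨id, by simpa using hid⟩
  have hc : IsStarMap G k c := (Finset.mem_filter.1 hcmem).2
  replace hmax : ∀ c', IsStarMap G k c' →
      (cov c').card * (W.card + 1) + (agree c').card ≤
        (cov c).card * (W.card + 1) + (agree c).card :=
    fun c' h => hmax c' (by simpa using h)
  refine ⟨c, hc, fun w hwW => ?_⟩
  by_contra hw
  rw [Finset.mem_coe] at hwW
  have hadj := hf w hwW
  have hne := hadj.ne
  have hno : ∀ c', IsStarMap G k c' →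
      ¬ (w ∈ starMapCover c' ∧ ∀ v ∈ W, v ∈ starMapCover c → v ∈ starMapCover c') := by
    rintro c' hc' ⟨hw', hsub⟩
    have hss : insert w (cov c) ⊆ cov c' := by
      intro v hv
      simp only [cov, Finset.mem_insert, Finset.mem_filter] at hv ⊢
      rcases hv with rfl | ⟨h1, h2⟩
      · exact ⟨hwW, hw'⟩
      · exact ⟨h1, hsub v h1 h2⟩
    have h1 := Finset.card_le_card hss
    rw [Finset.card_insert_of_notMem (by simp [cov, hw])] at h1
    have h2 := hmax c' hc'
    have h3 : (agree c).card ≤ W.card := Finset.card_filter_le _ _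
    nlinarith
  have hw0 := hw
  simp only [starMapCover, Set.mem_ofPred_eq, not_or, not_exists, not_and, not_not] at hw0
  obtain ⟨hw1, hw2⟩ := hw0
  obtain ⟨h1, h2, h3⟩ := id hc
  by_cases hu : c (f w) = f w
  · rcases lt_or_ge (Finset.univ.filter fun v => c v = f w ∧ v ≠ f w).card k with hlt | hge
    · refine hno _ (hc.update_of_card_lt hw hadj hu hlt) ⟨?_, fun v _ => ?_⟩
      · simp only [starMapCover, Function.update_apply, Set.mem_ofPred_eq]; grind
      · simp only [starMapCover, Function.update_apply, Set.mem_ofPred_eq]; grind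
    · obtain ⟨y, hyF, hyW⟩ : ∃ y ∈ Finset.univ.filter fun v => c v = f w ∧ v ≠ f w,
          y ∉ W.filter fun v => f v = f w := by
        by_contra! hcon
        have hss : insert w (Finset.univ.filter fun v => c v = f w ∧ v ≠ f w) ⊆
            W.filter fun v => f v = f w :=
          Finset.insert_subset (Finset.mem_filter.2 ⟨hwW, rfl⟩) hcon
        have h4 := Finset.card_le_card hss
        rw [Finset.card_insert_of_notMem (by simp [hw1, hne])] at h4
        have := hfk (f w)
        omega
      obtain ⟨-, hy, hyu⟩ := Finset.mem_filter.1 hyF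
      have hyw : y ≠ w := by
        rintro rfl
        exact hne (hw1.symm.trans hy)
      have hc' := hc.swap hw hadj hu hy hyu
      set c' := Function.update (Function.update c w (f w)) y y with hc'def
      have hw' : w ∈ starMapCover c' := by
        simp only [hc'def, starMapCover, Function.update_apply, Set.mem_ofPred_eq]; grind
      have hcov : ∀ v, v ≠ y → v ∈ starMapCover c → v ∈ starMapCover c' := by
        intro v
        simp only [hc'def, starMapCover, Function.update_apply, Set.mem_ofPred_eq]; grind
      by_cases hyW' : y ∈ W
      · have hfy : f y ≠ f w := fun h => hyW (Finset.mem_filter.2 ⟨hyW', h⟩)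
        have hycov : y ∈ cov c :=
          Finset.mem_filter.2 ⟨hyW', Or.inl (by rw [hy]; exact hyu.symm)⟩
        have hss : insert w ((cov c).erase y) ⊆ cov c' := by
          intro v hv
          simp only [cov, Finset.mem_insert, Finset.mem_filter, Finset.mem_erase] at hv ⊢
          rcases hv with rfl | ⟨h1, h2, h3⟩
          · exact ⟨hwW, hw'⟩
          · exact ⟨h2, hcov v h1 h3⟩
        have h4 := Finset.card_le_card hss
        rw [Finset.card_insert_of_notMem (by simp [cov, hw]),
          Finset.card_erase_add_one hycov] at h4
        have hss' : insert w (agree c) ⊆ agree c' := by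
          intro v
          simp only [agree, hc'def, Finset.mem_insert, Finset.mem_filter,
            Function.update_apply]
          grind
        have h5 := Finset.card_le_card hss'
        rw [Finset.card_insert_of_notMem (by simp [agree, hw1])] at h5
        have h6 := hmax c' hc'
        nlinarith
      · exact hno c' hc' ⟨hw', fun v hv => hcov v (by rintro rfl; exact hyW' hv)⟩
  · by_cases honly : ∀ d, c d = c (f w) → d ≠ c (f w) → d = f w
    · refine hno _ (hc.flip hk hw hadj hu honly) ⟨?_, fun v _ => ?_⟩
      · simp only [starMapCover, Function.update_apply, Set.mem_ofPred_eq]; grind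
      · simp only [starMapCover, Function.update_apply, Set.mem_ofPred_eq]; grind
    · push Not at honly
      obtain ⟨d, hd1, hd2, hd3⟩ := honly
      refine hno _ (hc.detach (by omega) hw hadj hu) ⟨?_, fun v _ => ?_⟩
      · simp only [starMapCover, Function.update_apply, Set.mem_ofPred_eq]; grind
      · simp only [starMapCover, Function.update_apply, Set.mem_ofPred_eq]; grind

end Augment

open Classical in
theorem exists_packing_of_hallCondition [Fintype V] {G : SimpleGraph V} {k : ℕ} (hk : 2 ≤ k)
    {W : Finset V} (hW : HallCondition k (fun v => G.neighborFinset v) W) :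
    ∃ P : Set (GStar G), IsKMinusPacking k P ∧ (W : Set V) ⊆ coverSet P := by
  obtain ⟨f, hf, hfk⟩ := hW.exists_fiber_card_le
  obtain ⟨c, hc, hcW⟩ := exists_isStarMap_cover hk (fun w hw => by simpa using hf w hw) hfk
  obtain ⟨P, hP, hcP⟩ := exists_packing_of_isStarMap hc
  exact ⟨P, hP, hcW.trans hcP⟩

/-- Lemma 8 of the paper: for every optimal `k⁻/t`-star packing `Q*` there is an optimal
`k⁻`-star packing `Q0` whose uncovered vertices are all uncovered by `Q*`. -/
theorem exists_optimal_kminus_refining [Fintype V] (G : SimpleGraph V) (k t : ℕ)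
    (ht : 2 ≤ t) (htk : t < k)
    (Qstar : Set (GStar G)) (hQstar : IsOptimalKtPacking k t Qstar) :
    ∃ Q0 : Set (GStar G), IsOptimalKMinusPacking k Q0 ∧
      (coverSet Q0)ᶜ ⊆ (coverSet Qstar)ᶜ := by
  classical
  have hstar : IsKMinusPacking k Qstar :=
    ⟨fun S hS => ⟨(hQstar.1.1 S hS).1, (hQstar.1.1 S hS).2.1⟩, hQstar.1.2⟩
  have hA : ∃ A ∈ (Finset.univ : Finset (Finset V)).filter fun A =>
        (coverSet Qstar).toFinset ⊆ A ∧ HallCondition k (fun v => G.neighborFinset v) A,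
      ∀ B ∈ (Finset.univ : Finset (Finset V)).filter fun A =>
        (coverSet Qstar).toFinset ⊆ A ∧ HallCondition k (fun v => G.neighborFinset v) A,
      B.card ≤ A.card :=
    Finset.exists_max_image _ _
      ⟨(coverSet Qstar).toFinset, Finset.mem_filter.2
        ⟨Finset.mem_univ _, subset_rfl, by convert hallCondition_coverSet hstar⟩⟩
  simp only [Finset.mem_filter, Finset.mem_univ, true_and] at hA
  obtain ⟨A, ⟨hsub, hHall⟩, hmax⟩ := hA
  obtain ⟨P, hP, hAP⟩ := exists_packing_of_hallCondition (G := G) (k := k) (by omega)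
    (W := A) (by convert hHall)
  refine ⟨P, ⟨hP, fun Q' hQ' => ?_⟩, Set.compl_subset_compl.2 fun v hv =>
    hAP (hsub (Set.mem_toFinset.2 hv))⟩
  have hB : HallCondition k (fun v => G.neighborFinset v) (coverSet Q').toFinset := by
    convert hallCondition_coverSet hQ'
  have hcard := HallCondition.card_le_of_maximal (by omega) hHall (fun b hb hins => by
    have := hmax _ ⟨hsub.trans (Finset.subset_insert _ _), hins⟩
    rw [Finset.card_insert_of_notMem hb] at this
    omega) hB
  calc (coverSet Q').ncard = (coverSet Q').toFinset.card := Set.ncard_eq_toFinset_card' _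
    _ ≤ A.card := hcard
    _ = (A : Set V).ncard := (Set.ncard_coe_finset A).symm
    _ ≤ (coverSet P).ncard := Set.ncard_le_ncard hAP (Set.toFinite _)
end

section
/- Let G be a finite simple graph, let k ≥ 2 be an integer, and let Q0 be an optimal k^−-star packing of G. Then every neighbor in G of a vertex uncovered by Q0 is the center of a star of Q0 having exactly k satellites. -/
open SimpleGraph

variable {V : Type*}

@[simp] theorem coverSet_singleton {G : SimpleGraph V} (S : GStar G) :
    coverSet {S} = S.verts := by
  simp [coverSet]

@[simp] theorem coverSet_pair {G : SimpleGraph V} (S T : GStar G) :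
    coverSet {S, T} = S.verts ∪ T.verts := by
  simp [coverSet]

theorem isKMinusPacking_singleton {G : SimpleGraph V} {k : ℕ} {S : GStar G}
    (hS : OkStar k S) : IsKMinusPacking k {S} :=
  ⟨by rintro T rfl; exact hS, Set.pairwise_singleton _ _⟩

theorem isKMinusPacking_pair {G : SimpleGraph V} {k : ℕ} {S T : GStar G}
    (hS : OkStar k S) (hT : OkStar k T) (hST : Disjoint S.verts T.verts) :
    IsKMinusPacking k {S, T} := by
  refine ⟨?_, ?_⟩
  · rintro U (rfl | rfl)
    exacts [hS, hT]
  · exact Set.pairwise_pair.2 fun _ => ⟨hST, hST.symm⟩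

/-- Replacing the stars of `R` by those of `N`. -/
theorem IsKMinusPacking.exchange {G : SimpleGraph V} {k : ℕ} {Q R N : Set (GStar G)}
    (hQ : IsKMinusPacking k Q) (hR : R ⊆ Q) (hN : IsKMinusPacking k N)
    (hNR : coverSet N ⊆ coverSet R ∪ (coverSet Q)ᶜ) :
    IsKMinusPacking k ((Q \ R) ∪ N) := by
  have key : ∀ S ∈ Q \ R, ∀ T ∈ N, Disjoint S.verts T.verts := by
    rintro S ⟨hSQ, hSR⟩ T hT
    refine Set.disjoint_left.2 fun x hxS hxT => ?_
    rcases hNR (Set.mem_biUnion hT hxT) with hx | hx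
    · obtain ⟨U, hU, hxU⟩ := Set.mem_iUnion₂.1 hx
      have hne : S ≠ U := fun h => hSR (h ▸ hU)
      exact Set.disjoint_left.1 (hQ.2 hSQ (hR hU) hne) hxS hxU
    · exact hx (Set.mem_biUnion hSQ hxS)
  refine ⟨?_, ?_⟩
  · rintro S (hS | hS)
    exacts [hQ.1 S hS.1, hN.1 S hS]
  · rintro S (hS | hS) T (hT | hT) hne
    exacts [hQ.2 hS.1 hT.1 hne, key S hS T hT, (key T hT S hS).symm, hN.2 hS hT hne]

/-- In an optimal packing, no exchange of stars gains a vertex. -/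
theorem IsOptimalKMinusPacking.coverSet_subset [Finite V] {G : SimpleGraph V} {k : ℕ}
    {Q R N : Set (GStar G)} (hQ : IsOptimalKMinusPacking k Q) (hR : R ⊆ Q)
    (hN : IsKMinusPacking k N) (hRN : coverSet R ⊆ coverSet N)
    (hNR : coverSet N ⊆ coverSet R ∪ (coverSet Q)ᶜ) : coverSet N ⊆ coverSet Q := by
  have hunion : coverSet ((Q \ R) ∪ N) = coverSet (Q \ R) ∪ coverSet N :=
    Set.biUnion_union _ _ _
  have hle := hQ.2 _ (hQ.1.exchange hR hN hNR)
  have hsub : coverSet Q ⊆ coverSet ((Q \ R) ∪ N) := by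
    intro x hx
    obtain ⟨S, hS, hxS⟩ := Set.mem_iUnion₂.1 hx
    rw [hunion]
    by_cases hSR : S ∈ R
    · exact Or.inr (hRN (Set.mem_biUnion hSR hxS))
    · exact Or.inl (Set.mem_biUnion (⟨hS, hSR⟩ : S ∈ Q \ R) hxS)
  rw [Set.eq_of_subset_of_ncard_le hsub hle (Set.toFinite _), hunion]
  exact Set.subset_union_right

/-- No packing covers exactly the vertices of one star of an optimal packing together with
one vertex uncovered by the optimal packing. -/
theorem IsOptimalKMinusPacking.coverSet_ne_insert [Finite V] {G : SimpleGraph V} {k : ℕ}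
    {Q N : Set (GStar G)} (hQ : IsOptimalKMinusPacking k Q) {S : GStar G} (hS : S ∈ Q)
    (hN : IsKMinusPacking k N) {v : V} (hv : v ∉ coverSet Q) :
    coverSet N ≠ insert v S.verts := by
  intro h
  refine hv (hQ.coverSet_subset (Set.singleton_subset_iff.2 hS) hN ?_ ?_ ?_)
  · rw [h, coverSet_singleton]
    exact Set.subset_insert _ _
  · rw [h, coverSet_singleton]
    exact Set.insert_subset (Or.inr hv) Set.subset_union_left
  · rw [h]
    exact Set.mem_insert _ _

/-- The star with one satellite given by an edge. -/
def edgeStar {G : SimpleGraph V} {u v : V} (h : G.Adj u v) : GStar G where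
  center := u
  sats := {v}
  center_not_mem := by simpa using h.ne
  adj := by simpa using h

theorem okStar_edgeStar {G : SimpleGraph V} {k : ℕ} (hk : 1 ≤ k) {u v : V}
    (h : G.Adj u v) : OkStar k (edgeStar h) := by
  simpa [OkStar, edgeStar] using hk

@[simp] theorem verts_edgeStar {G : SimpleGraph V} {u v : V} (h : G.Adj u v) :
    (edgeStar h).verts = {u, v} := by
  simp [GStar.verts, edgeStar]

/-- In an optimal `k⁻`-star packing, every neighbor of an uncovered vertex is the center
of a star of the packing having exactly `k` satellites. -/
theorem uncovered_neighbors_are_kstar_centers [Fintype V] (G : SimpleGraph V) (k : ℕ)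
    (hk : 2 ≤ k) (Q0 : Set (GStar G)) (hQ0 : IsOptimalKMinusPacking k Q0) :
    ∀ v : V, v ∉ coverSet Q0 → ∀ u : V, G.Adj v u →
      ∃ S ∈ Q0, S.center = u ∧ S.sats.card = k := by
  classical
  intro v hv u hvu
  have hE : OkStar k (edgeStar hvu.symm) := okStar_edgeStar (by omega) _
  by_cases hu : u ∈ coverSet Q0
  swap
  · refine absurd ?_ hv
    refine hQ0.coverSet_subset (R := ∅) (Set.empty_subset _) (isKMinusPacking_singleton hE)
      (by simp [coverSet]) ?_ (by simp)
    rw [coverSet_singleton, verts_edgeStar]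
    rintro x (rfl | rfl)
    exacts [Or.inr hu, Or.inr hv]
  obtain ⟨S, hS, huS⟩ := Set.mem_iUnion₂.1 hu
  have hvS : v ∉ S.verts := fun h => hv (Set.mem_biUnion hS h)
  have hvc : v ≠ S.center := fun h => hvS (Or.inl h)
  have hvs : v ∉ S.sats := fun h => hvS (Or.inr h)
  obtain ⟨hS1, hSk⟩ := hQ0.1.1 S hS
  rcases huS with rfl | hus
  · refine ⟨S, hS, rfl, ?_⟩
    by_contra hne
    let T : GStar G :=
      { center := S.center
        sats := insert v S.sats
        center_not_mem := by simp [hvc.symm, S.center_not_mem]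
        adj := by
          intro w hw
          rcases Finset.mem_insert.1 hw with rfl | hw
          exacts [hvu.symm, S.adj w hw] }
    have hT : OkStar k T := by
      have : T.sats.card = S.sats.card + 1 := Finset.card_insert_of_notMem hvs
      exact ⟨by omega, by omega⟩
    refine hQ0.coverSet_ne_insert hS (isKMinusPacking_singleton hT) hv ?_
    simp [T, GStar.verts, Set.insert_comm]
  · exfalso
    have hus : u ∈ S.sats := hus
    have hcu : S.center ≠ u := fun h => S.center_not_mem (h ▸ hus)
    by_cases h1 : S.sats.card = 1
    · obtain ⟨w, hw⟩ := Finset.card_eq_one.1 h1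
      obtain rfl : u = w := by simpa [hw] using hus
      let T : GStar G :=
        { center := u
          sats := {v, S.center}
          center_not_mem := by simp [hvu.ne', hcu.symm]
          adj := by simpa using ⟨hvu.symm, (S.adj u hus).symm⟩ }
      have hT : OkStar k T := by
        have : T.sats.card = 2 := Finset.card_pair hvc
        exact ⟨by omega, by omega⟩
      refine hQ0.coverSet_ne_insert hS (isKMinusPacking_singleton hT) hv ?_
      ext x
      simp only [coverSet_singleton, T, GStar.verts, hw, Finset.coe_insert, Finset.coe_singleton,
        Set.mem_insert_iff, Set.mem_singleton_iff]
      tauto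
    · let T : GStar G :=
        { center := S.center
          sats := S.sats.erase u
          center_not_mem := by simp [S.center_not_mem]
          adj := fun w hw => S.adj w (Finset.mem_of_mem_erase hw) }
      have hT : OkStar k T := by
        have : T.sats.card = S.sats.card - 1 := Finset.card_erase_of_mem hus
        exact ⟨by omega, by omega⟩
      have hdisj : Disjoint T.verts (edgeStar hvu.symm).verts := by
        rw [verts_edgeStar]
        simp [T, GStar.verts, hcu.symm, hvc, hvs]
      refine hQ0.coverSet_ne_insert hS (isKMinusPacking_pair hT hE hdisj) hv ?_
      have hxu : ∀ x, x = u → x ∈ S.sats := fun x hx => hx ▸ hus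
      rw [coverSet_pair, verts_edgeStar]
      ext x
      have := hxu x
      simp [T, GStar.verts]
      tauto
end
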